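/- (Wedderburn's theorem for Severi-Brauer varieties) Over a finite field F_q, every Severi-Brauer variety is trivial; that is, every F_q-variety P with P_{k̄} ≅ P^{dim P}_{k̄} is isomorphic over F_q to projective space P^{dim P}_{F_q}. -/

import Mathlib

/-!
STATEMENT 5 (Wedderburn's theorem for Severi–Brauer varieties; Kollár, Corollary 12 /
`split.lem.cor.5`):

Over a finite field `F_q`, every Severi–Brauer variety is trivial; that is, every
`F_q`-variety `P` with `P_{k̄} ≅ ℙ^{dim P}_{k̄}` is isomorphic over `F_q` to projective space
`ℙ^{dim P}_{F_q}`.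
-/

noncomputable section
universe u
open AlgebraicGeometry CategoryTheory CategoryTheory.Limits

attribute [local instance] MvPolynomial.gradedAlgebra

/-- Projective `n`-space over `R`, as `Proj R[x_0,…,x_n]`. -/
def ProjectiveSpace (R : Type u) [CommRing R] (n : ℕ) : Scheme.{u} :=
  Proj (MvPolynomial.homogeneousSubmodule (Fin (n + 1)) R)

/-- The structure morphism `ℙⁿ_R ⟶ Spec R`. -/
def ProjectiveSpace.toSpec (R : Type u) [CommRing R] (n : ℕ) :
    ProjectiveSpace R n ⟶ Spec (CommRingCat.of R) :=
  Proj.toSpecZero _ ≫ Spec.map (CommRingCat.ofHom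
    (algebraMap R (MvPolynomial.homogeneousSubmodule (Fin (n + 1)) R 0)))

/-- Base change of an `k`-scheme along a ring homomorphism `k →+* K`. -/
def schemeBaseChange {k K : Type u} [CommRing k] [CommRing K] (f : k →+* K)
    {X : Scheme.{u}} (sX : X ⟶ Spec (CommRingCat.of k)) : Scheme.{u} :=
  pullback sX (Spec.map (CommRingCat.ofHom f))

def schemeBaseChange.toSpec {k K : Type u} [CommRing k] [CommRing K] (f : k →+* K)
    {X : Scheme.{u}} (sX : X ⟶ Spec (CommRingCat.of k)) :
    schemeBaseChange f sX ⟶ Spec (CommRingCat.of K) :=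
  pullback.snd _ _

/-- `P` (with structure morphism `sP`) is a Severi–Brauer variety of dimension `n` over `k`. -/
structure IsSeveriBrauer {k : Type u} [Field k] {P : Scheme.{u}}
    (sP : P ⟶ Spec (CommRingCat.of k)) (n : ℕ) : Prop where
  proper : IsProper sP
  exists_iso : ∃ e : schemeBaseChange (algebraMap k (AlgebraicClosure k)) sP ≅
      ProjectiveSpace (AlgebraicClosure k) n,
    e.hom ≫ ProjectiveSpace.toSpec (AlgebraicClosure k) n =
      schemeBaseChange.toSpec (algebraMap k (AlgebraicClosure k)) sP

section

open Polynomial in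
theorem exists_ne_zero_recurrence {K : Type*} [Field K] [IsAlgClosed K] {q : ℕ} (hq : 1 < q)
    (a : ℕ → K) (h0 : a 0 ≠ 0) (m : ℕ) :
    ∃ b : ℕ → K, b m ≠ 0 ∧ b 0 = a 0 * b m ^ q ∧
      ∀ i, b (i + 1) = b i ^ q + a (i + 1) * b m ^ q := by
  let B : ℕ → K[X] := fun i ↦ Nat.rec (C (a 0) * X ^ q) (fun i p ↦ p ^ q + C (a (i + 1)) * X ^ q) i
  have B0 : B 0 = C (a 0) * X ^ q := rfl
  have Bs (i) : B (i + 1) = B i ^ q + C (a (i + 1)) * X ^ q := rfl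
  have hdeg (i) : (B i).natDegree = q ^ (i + 1) := by
    induction i with
    | zero => rw [B0, natDegree_C_mul_X_pow _ _ h0]; simp
    | succ i ih =>
      have h1 : (B i ^ q).natDegree = q ^ (i + 2) := by
        rw [natDegree_pow, ih]; ring
      rw [Bs, natDegree_add_eq_left_of_natDegree_lt, h1]
      rw [h1]
      refine (natDegree_C_mul_X_pow_le _ _).trans_lt ?_
      calc q = q ^ 1 := (pow_one q).symm
        _ < q ^ (i + 2) := Nat.pow_lt_pow_right hq (by omega)
  have hdvd (i) : X ^ 2 ∣ B i := by
    have hX : (X : K[X]) ^ 2 ∣ X ^ q := pow_dvd_pow _ hq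
    induction i with
    | zero => exact hX.mul_left _
    | succ i ih => exact dvd_add (ih.trans (dvd_pow_self _ (by omega))) (hX.mul_left _)
  obtain ⟨Q, hQ⟩ := hdvd m
  have hQ' : (X * Q - 1).degree ≠ 0 := by
    intro h
    have h1 := eq_C_of_degree_eq_zero h
    have h2 : B m = X * (1 + C ((X * Q - 1).coeff 0)) := by
      rw [← h1, hQ]; ring
    have h3 := hdeg m
    have h4 : 1 < q ^ (m + 1) := Nat.one_lt_pow (by omega) hq
    have h5 : (B m).natDegree ≤ 1 := by
      rw [h2, ← C_1, ← C_add]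
      exact (natDegree_mul_C_le _ _).trans natDegree_X_le
    omega
  obtain ⟨t, ht⟩ := IsAlgClosed.exists_root _ hQ'
  have ht0 : t ≠ 0 := by
    rintro rfl
    simp [IsRoot] at ht
  have htm : (B m).eval t = t := by
    have h1 : t * Q.eval t = 1 := by simpa [IsRoot, sub_eq_zero] using ht
    rw [hQ]; simp only [eval_mul, eval_pow, eval_X]
    linear_combination t * h1
  refine ⟨fun i ↦ (B i).eval t, ?_, ?_, fun i ↦ ?_⟩
  · simpa only [htm] using ht0
  · simp only [htm]; simp [B0]
  · simp only [htm, Bs]; simp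

theorem exists_ne_zero_fixed {K V : Type*} [Field K] [IsAlgClosed K] [AddCommGroup V] [Module K V]
    [FiniteDimensional K V] {σ : K →+* K} {q : ℕ} (hq : 1 < q) (hσ : ∀ x, σ x = x ^ q)
    (Φ : V →ₛₗ[σ] V) (hΦ : Function.Injective Φ) [Nontrivial V] : ∃ w : V, w ≠ 0 ∧ Φ w = w := by
  classical
  have σsurj : Function.Surjective σ := fun y ↦ by
    obtain ⟨x, hx⟩ := IsAlgClosed.exists_pow_nat_eq y (n := q) (by omega)
    exact ⟨x, by rw [hσ, hx]⟩
  obtain ⟨v, hv⟩ := exists_ne (0 : V)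
  let P : ℕ → Prop := fun r ↦ LinearIndependent K (fun i : Fin r ↦ Φ^[i] v)
  have hex : ∃ r, ¬ P r := ⟨Module.finrank K V + 1, fun h ↦ by
    have := h.fintype_card_le_finrank
    simp at this⟩
  obtain ⟨r, hr, hmin⟩ : ∃ r, ¬ P r ∧ ∀ s < r, P s :=
    ⟨Nat.find hex, Nat.find_spec hex, fun s hs ↦ not_not.mp (Nat.find_min hex hs)⟩
  have P0 : P 0 := linearIndependent_empty_type
  have P1 : P 1 := by
    exact linearIndependent_unique_iff.mpr (by simpa using hv)
  obtain ⟨m, rfl⟩ : ∃ m, r = m + 2 := by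
    refine ⟨r - 2, ?_⟩
    rcases r with _ | _ | r
    · exact absurd P0 hr
    · exact absurd P1 hr
    · rfl
  have hPm := hmin (m + 1) (by omega)
  have succ_iff (s) : P (s + 1) ↔
      P s ∧ Φ^[s] v ∉ Submodule.span K (Set.range fun i : Fin s ↦ Φ^[i] v) := by
    have := linearIndependent_finSucc' (K := K) (v := fun i : Fin (s + 1) ↦ Φ^[i] v)
    exact this
  have hmem : Φ^[m + 1] v ∈ Submodule.span K (Set.range fun i : Fin (m + 1) ↦ Φ^[i] v) := by
    by_contra h
    exact hr ((succ_iff _).mpr ⟨hPm, h⟩)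
  obtain ⟨c, hc⟩ := (Submodule.mem_span_range_iff_exists_fun K).mp hmem
  let a : ℕ → K := fun i ↦ if h : i < m + 1 then c ⟨i, h⟩ else 0
  have ha : ∑ i ∈ Finset.range (m + 1), a i • Φ^[i] v = Φ^[m + 1] v := by
    rw [← hc, ← Fin.sum_univ_eq_sum_range (fun i ↦ a i • Φ^[i] v)]
    simp only [a, Fin.is_lt, dif_pos, Fin.eta]
  have ha0 : a 0 ≠ 0 := by
    intro h0
    rw [Finset.sum_range_succ', h0, zero_smul, add_zero] at ha
    choose τ hτ using σsurj
    have hit (i : ℕ) : Φ (Φ^[i] v) = Φ^[i + 1] v := (Function.iterate_succ_apply' Φ i v).symm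
    have h1 : Φ (∑ i ∈ Finset.range m, τ (a (i + 1)) • Φ^[i] v) = Φ (Φ^[m] v) := by
      rw [hit, ← ha, map_sum]
      refine Finset.sum_congr rfl fun i _ ↦ ?_
      rw [map_smulₛₗ, hτ, hit]
    have h2 := hΦ h1
    refine ((succ_iff m).mp hPm).2 ?_
    rw [← h2]
    refine Submodule.sum_mem _ fun i hi ↦ Submodule.smul_mem _ _ (Submodule.subset_span ?_)
    exact ⟨⟨i, Finset.mem_range.mp hi⟩, rfl⟩
  obtain ⟨b, hbm, hb0, hbs⟩ := exists_ne_zero_recurrence hq a ha0 m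
  refine ⟨∑ i ∈ Finset.range (m + 1), b i • Φ^[i] v, fun h ↦ hbm ?_, ?_⟩
  · rw [← Fin.sum_univ_eq_sum_range (fun i ↦ b i • Φ^[i] v)] at h
    exact Fintype.linearIndependent_iff.mp hPm (fun i ↦ b i) h (Fin.last m)
  · have hit (i : ℕ) : Φ (Φ^[i] v) = Φ^[i + 1] v := (Function.iterate_succ_apply' Φ i v).symm
    rw [map_sum]
    simp_rw [map_smulₛₗ, hσ, hit]
    rw [Finset.sum_range_succ, ← ha, Finset.smul_sum, Finset.sum_range_succ' _ m,
      Finset.sum_range_succ' (fun i ↦ b i • Φ^[i] v), ← add_assoc, ← Finset.sum_add_distrib, hb0]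
    simp_rw [hbs, add_smul, smul_smul, mul_comm]

theorem exists_fixed_basis {K : Type*} [Field K] [IsAlgClosed K] {σ : K →+* K} {q : ℕ}
    (hq : 1 < q) (hσ : ∀ x, σ x = x ^ q) (d : ℕ) {V : Type*} [AddCommGroup V] [Module K V]
    [FiniteDimensional K V] (hd : Module.finrank K V = d)
    (Φ : V →ₛₗ[σ] V) (hΦ : Function.Injective Φ) :
    ∃ b : Fin d → V, LinearIndependent K b ∧ ∀ i, Φ (b i) = b i := by
  induction d generalizing V with
  | zero => exact ⟨Fin.elim0, linearIndependent_empty_type, fun i ↦ i.elim0⟩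
  | succ d ih =>
    have : Nontrivial V := Module.nontrivial_of_finrank_pos (R := K) (by omega)
    obtain ⟨w, hw, hΦw⟩ := exists_ne_zero_fixed hq hσ Φ hΦ
    have σsurj : Function.Surjective σ := fun y ↦ by
      obtain ⟨x, hx⟩ := IsAlgClosed.exists_pow_nat_eq y (n := q) (by omega)
      exact ⟨x, by rw [hσ, hx]⟩
    let W := Submodule.span K {w}
    have hle : W ≤ W.comap Φ := by
      rw [Submodule.span_singleton_le_iff_mem, Submodule.mem_comap, hΦw]
      exact Submodule.mem_span_singleton_self w
    let Ψ : (V ⧸ W) →ₛₗ[σ] (V ⧸ W) := W.mapQ W Φ hle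
    have hΨ : Function.Injective Ψ := by
      rw [injective_iff_map_eq_zero]
      intro x hx
      obtain ⟨v, rfl⟩ := W.mkQ_surjective x
      have h1 : Φ v ∈ W := by
        rwa [← Submodule.Quotient.mk_eq_zero]
      obtain ⟨c, hc⟩ := Submodule.mem_span_singleton.mp h1
      obtain ⟨c, rfl⟩ := σsurj c
      have : v = c • w := hΦ (by rw [map_smulₛₗ, hΦw, hc])
      rw [Submodule.mkQ_apply, Submodule.Quotient.mk_eq_zero, this]
      exact Submodule.smul_mem _ _ (Submodule.mem_span_singleton_self w)
    have hfr : Module.finrank K (V ⧸ W) = d := by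
      have := W.finrank_quotient_add_finrank
      rw [finrank_span_singleton hw] at this
      omega
    obtain ⟨b, hb, hbfix⟩ := ih hfr Ψ hΨ
    have key (i) : ∃ v : V, W.mkQ v = b i ∧ Φ v = v := by
      obtain ⟨v, hv⟩ := W.mkQ_surjective (b i)
      have h1 : Φ v - v ∈ W := by
        rw [← Submodule.Quotient.eq]
        have := hbfix i
        rw [← hv] at this
        exact this
      obtain ⟨c, hc⟩ := Submodule.mem_span_singleton.mp h1
      have hdeg : (Polynomial.X ^ q - Polynomial.X + Polynomial.C c).degree ≠ 0 := by
        have : (Polynomial.X ^ q - Polynomial.X + Polynomial.C c).natDegree = q := by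
          compute_degree!
          · rw [if_neg (by omega)]; simp [show q ≠ 0 by omega]
          · omega
        intro h
        have h0 := Polynomial.natDegree_eq_zero_iff_degree_le_zero.mpr h.le
        omega
      obtain ⟨t, ht⟩ := IsAlgClosed.exists_root _ hdeg
      refine ⟨v + t • w, ?_, ?_⟩
      · rw [map_add, hv, map_smul]
        have : W.mkQ w = 0 := by
          rw [Submodule.mkQ_apply, Submodule.Quotient.mk_eq_zero]
          exact Submodule.mem_span_singleton_self w
        rw [this, smul_zero, add_zero]
      · rw [map_add, map_smulₛₗ, hΦw, hσ, ← sub_eq_zero]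
        simp only [Polynomial.IsRoot, Polynomial.eval_add, Polynomial.eval_sub, Polynomial.eval_pow,
          Polynomial.eval_X, Polynomial.eval_C] at ht
        have : Φ v + t ^ q • w - (v + t • w) = (t ^ q - t + c) • w := by
          rw [add_smul, sub_smul, hc]; abel
        rw [this, ht, zero_smul]
    choose v hvb hv using key
    refine ⟨Fin.cons w v, ?_, fun i ↦ ?_⟩
    · rw [linearIndependent_finCons]
      refine ⟨?_, fun hmem ↦ ?_⟩
      · refine LinearIndependent.of_comp W.mkQ ?_
        have : W.mkQ ∘ v = b := funext hvb
        rwa [this]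
      · obtain ⟨c, hc⟩ := (Submodule.mem_span_range_iff_exists_fun K).mp hmem
        have h0 : ∑ i, c i • b i = 0 := by
          have := congrArg W.mkQ hc
          rw [map_sum] at this
          simp_rw [map_smul, hvb] at this
          rw [this, Submodule.mkQ_apply, Submodule.Quotient.mk_eq_zero]
          exact Submodule.mem_span_singleton_self w
        have hc0 := Fintype.linearIndependent_iff.mp hb c h0
        apply hw
        rw [← hc]
        simp [hc0]
    · refine Fin.cases ?_ (fun i ↦ ?_) i
      · simpa using hΦw
      · simpa using hv i

end

section
open TensorProduct

/-- The map `K ⊗ K → K`, `a ⊗ b ↦ a * σ^i b`. -/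
def twistedMul {k K : Type*} [Field k] [Field K] [Algebra k K] (σ : K ≃ₐ[k] K) (i : ℕ) :
    K ⊗[k] K →ₐ[k] K :=
  Algebra.TensorProduct.lift (AlgHom.id k K) ((σ ^ i : K ≃ₐ[k] K) : K →ₐ[k] K)
    fun _ _ ↦ mul_comm _ _

theorem twistedMul_tmul {k K : Type*} [Field k] [Field K] [Algebra k K] (σ : K ≃ₐ[k] K) (i : ℕ)
    (a b : K) : twistedMul σ i (a ⊗ₜ b) = a * (σ ^ i) b :=
  Algebra.TensorProduct.lift_tmul _ _ _ _ _

theorem eq_zero_of_sum_mul_pow_apply {k K ι : Type*} [Field k] [Field K] [Algebra k K]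
    (σ : K ≃ₐ[k] K) (hfix : ∀ x, σ x = x → x ∈ (algebraMap k K).range) (y : ι → K)
    (hy : LinearIndependent k y) (s : Finset ι) (x : ι → K)
    (hx : ∀ i : ℕ, ∑ j ∈ s, x j * (σ ^ i) (y j) = 0) : ∀ j ∈ s, x j = 0 := by
  classical
  induction s using Finset.induction generalizing x with
  | empty => simp
  | insert a s ha ih =>
    by_cases h0 : x a = 0
    · have := ih x (fun i ↦ by simpa [Finset.sum_insert ha, h0] using hx i)
      intro j hj
      rcases Finset.mem_insert.mp hj with rfl | hj
      exacts [h0, this j hj]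
    exfalso
    let z : ι → K := fun j ↦ x j / x a
    have hz : ∀ i : ℕ, ∑ j ∈ insert a s, z j * (σ ^ i) (y j) = 0 := fun i ↦ by
      have := hx i
      calc _ = (∑ j ∈ insert a s, x j * (σ ^ i) (y j)) / x a := by
            rw [Finset.sum_div]
            exact Finset.sum_congr rfl fun j _ ↦ by simp only [z]; ring
        _ = 0 := by rw [this, zero_div]
    have hza : z a = 1 := div_self h0
    have hfixz : ∀ j ∈ s, z j - σ.symm (z j) = 0 := by
      refine ih _ fun i ↦ ?_
      have h1 := hz i
      have h2 := congrArg σ.symm (hz (i + 1))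
      rw [map_sum, map_zero] at h2
      have h3 : ∀ j, σ.symm (z j * (σ ^ (i + 1)) (y j)) = σ.symm (z j) * (σ ^ i) (y j) := fun j ↦ by
        rw [map_mul, pow_succ', AlgEquiv.mul_apply, AlgEquiv.symm_apply_apply]
      simp_rw [h3] at h2
      rw [Finset.sum_insert ha] at h1 h2
      simp_rw [sub_mul, Finset.sum_sub_distrib]
      rw [hza] at h1 h2
      rw [map_one] at h2
      linear_combination h1 - h2
    have hmem : ∀ j ∈ insert a s, ∃ c : k, algebraMap k K c = z j := by
      intro j hj
      rcases Finset.mem_insert.mp hj with rfl | hj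
      · exact ⟨1, by rw [hza, map_one]⟩
      · refine hfix (z j) ?_
        have := sub_eq_zero.mp (hfixz j hj)
        conv_lhs => rw [this]
        exact σ.apply_symm_apply _
    choose! c hc using hmem
    have h1 : ∑ j ∈ insert a s, c j • y j = 0 := by
      rw [← hz 0]
      refine Finset.sum_congr rfl fun j hj ↦ ?_
      rw [Algebra.smul_def, hc j hj]; simp
    have h2 := linearIndependent_iff'.mp hy _ _ h1 a (Finset.mem_insert_self a s)
    have h3 := hc a (Finset.mem_insert_self a s)
    rw [h2, hza, map_zero] at h3
    exact zero_ne_one h3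

theorem eq_zero_of_twistedMul {k K : Type*} [Field k] [Field K] [Algebra k K]
    (σ : K ≃ₐ[k] K) (hfix : ∀ x, σ x = x → x ∈ (algebraMap k K).range) (t : K ⊗[k] K)
    (ht : ∀ i, twistedMul σ i t = 0) : t = 0 := by
  classical
  let b := Module.Basis.ofVectorSpace k K
  let B := b.baseChange K
  rw [← B.repr.map_eq_zero_iff]
  ext j
  by_cases hj : j ∈ (B.repr t).support
  · refine eq_zero_of_sum_mul_pow_apply σ hfix b b.linearIndependent (B.repr t).support
      (fun j ↦ B.repr t j) (fun i ↦ ?_) j hj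
    rw [← ht i]
    conv_rhs => rw [← B.linearCombination_repr t]
    rw [Finsupp.linearCombination_apply, Finsupp.sum, map_sum]
    refine Finset.sum_congr rfl fun j _ ↦ ?_
    rw [Module.Basis.baseChange_apply, TensorProduct.smul_tmul', smul_eq_mul, mul_one,
      twistedMul_tmul]
  · simpa using hj

theorem isReduced_tensorProduct_self {k K : Type*} [Field k] [Field K] [Algebra k K]
    (σ : K ≃ₐ[k] K) (hfix : ∀ x, σ x = x → x ∈ (algebraMap k K).range) :
    IsReduced (K ⊗[k] K) where
  eq_zero t ht := eq_zero_of_twistedMul σ hfix t fun i ↦ (ht.map (twistedMul σ i)).eq_zero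

theorem mem_range_of_frobenius_eq {k K : Type*} [Field k] [Finite k] [Field K] [Algebra k K]
    {x : K} (hx : x ^ Nat.card k = x) : x ∈ (algebraMap k K).range := by
  classical
  have := Fintype.ofFinite k
  rw [Nat.card_eq_fintype_card] at hx
  have h1 : ((Polynomial.X ^ Fintype.card k - Polynomial.X : Polynomial k).map
      (algebraMap k K)).IsRoot x := by simp [hx]
  have h2 : (Polynomial.X ^ Fintype.card k - Polynomial.X : Polynomial k).Splits := by
    rw [Polynomial.splits_iff_card_roots, FiniteField.roots_X_pow_card_sub_X,
      FiniteField.X_pow_card_sub_X_natDegree_eq _ Fintype.one_lt_card]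
    rfl
  have h3 : x ∈ ((Polynomial.X ^ Fintype.card k - Polynomial.X : Polynomial k).map
      (algebraMap k K)).roots := by
    rw [Polynomial.mem_roots, ]
    · exact h1
    · rw [Polynomial.map_ne_zero_iff (algebraMap k K).injective]
      exact FiniteField.X_pow_card_sub_X_ne_zero _ Fintype.one_lt_card
  rw [h2.roots_map] at h3
  obtain ⟨c, -, hc⟩ := Multiset.mem_map.mp h3
  exact ⟨c, hc⟩

end

section
open HomogeneousLocalization MvPolynomial

section AwayLift
variable {A σ : Type*} [CommRing A] [SetLike σ A] [AddSubgroupClass σ A] (𝒜 : ℕ → σ)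
  [GradedRing 𝒜]

/-- The ring homomorphism out of a homogeneous localization induced by a ring homomorphism
inverting `s`. -/
def awayLift {s : A} {B : Type*} [CommRing B] (θ : A →+* B) (hs : IsUnit (θ s)) :
    Away 𝒜 s →+* B :=
  (IsLocalization.Away.lift (S := Localization.Away s) s hs).comp
    (algebraMap (Away 𝒜 s) (Localization.Away s))

theorem awayLift_mk {s : A} {B : Type*} [CommRing B] (θ : A →+* B) (hu : IsUnit (θ s)) {m : ℕ}
    (hs : s ∈ 𝒜 m) (n : ℕ) (a : A) (ha : a ∈ 𝒜 (n • m)) :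
    awayLift 𝒜 θ hu (Away.mk 𝒜 hs n a ha) * θ s ^ n = θ a := by
  rw [awayLift, RingHom.comp_apply, ← RingHom.map_pow θ,
    ← IsLocalization.Away.lift_eq (S := Localization.Away s) s hu (s ^ n), ← map_mul]
  rw [HomogeneousLocalization.algebraMap_apply, Away.val_mk, ← Localization.mk_one_eq_algebraMap,
    Localization.mk_mul]
  rw [← IsLocalization.Away.lift_eq (S := Localization.Away s) s hu a,
    ← Localization.mk_one_eq_algebraMap]
  congr 1
  rw [Localization.mk_eq_mk_iff, Localization.r_iff_exists]
  exact ⟨1, by simp [mul_comm]⟩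

theorem awayLift_comp {s : A} {B C : Type*} [CommRing B] [CommRing C] (θ : A →+* B)
    (hu : IsUnit (θ s)) {m : ℕ} (hs : s ∈ 𝒜 m) (g : B →+* C) :
    g.comp (awayLift 𝒜 θ hu) = awayLift 𝒜 (g.comp θ) (hu.map g) := by
  ext x
  obtain ⟨n, a, ha, rfl⟩ := Away.mk_surjective 𝒜 hs x
  refine ((hu.map g).pow n).mul_left_injective ?_
  change g _ * g (θ s) ^ n = _ * (g.comp θ) s ^ n
  rw [awayLift_mk, ← map_pow, ← map_mul, awayLift_mk]; rfl

theorem awayLift_comp_awayMap {s t : A} {B : Type*} [CommRing B] (θ : A →+* B)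
    (hu : IsUnit (θ (s * t))) (hu' : IsUnit (θ s)) {m m' : ℕ} (hs : s ∈ 𝒜 m) (ht : t ∈ 𝒜 m') :
    (awayLift 𝒜 θ hu).comp (awayMap 𝒜 ht rfl) = awayLift 𝒜 θ hu' := by
  ext x
  obtain ⟨n, a, ha, rfl⟩ := Away.mk_surjective 𝒜 hs x
  refine (hu.pow n).mul_left_injective ?_
  simp only [RingHom.comp_apply]
  rw [awayMap_mk 𝒜 ht rfl n hs a ha, awayLift_mk, map_mul, map_mul, mul_pow, ← mul_assoc,
    awayLift_mk, map_pow]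

theorem awayLift_comp_map {A' σ' : Type*} [CommRing A'] [SetLike σ' A'] [AddSubgroupClass σ' A']
    (ℬ : ℕ → σ') [GradedRing ℬ] (F : 𝒜 →+*ᵍ ℬ) {s : A} {B : Type*} [CommRing B] (θ : A' →+* B)
    (hu : IsUnit (θ (F s))) {m : ℕ} (hs : s ∈ 𝒜 m) :
    (awayLift ℬ θ hu).comp (Away.map F s) =
      awayLift 𝒜 (θ.comp (F : A →+* A')) (s := s) hu := by
  ext x
  obtain ⟨n, a, ha, rfl⟩ := Away.mk_surjective 𝒜 hs x
  refine (hu.pow n).mul_left_injective ?_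
  simp only [RingHom.comp_apply]
  rw [Away.map_mk, awayLift_mk]
  exact (awayLift_mk 𝒜 (θ.comp (F : A →+* A')) (s := s) hu hs n a ha).symm

end AwayLift

section ProjPoint
variable {A σ : Type u} [CommRing A] [SetLike σ A] [AddSubgroupClass σ A] (𝒜 : ℕ → σ)
  [GradedRing 𝒜]

/-- The point of `Proj 𝒜` with homogeneous coordinates given by `θ`. -/
def projPoint {s : A} {m : ℕ} (hs : s ∈ 𝒜 m) (hm : 0 < m) {B : Type u} [CommRing B] (θ : A →+* B)
    (hu : IsUnit (θ s)) : Spec (.of B) ⟶ Proj 𝒜 :=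
  Spec.map (CommRingCat.ofHom (awayLift 𝒜 θ hu)) ≫ Proj.awayι 𝒜 s hs hm

theorem SpecMap_projPoint {s : A} {m : ℕ} (hs : s ∈ 𝒜 m) (hm : 0 < m) {B C : Type u} [CommRing B]
    [CommRing C] (θ : A →+* B) (hu : IsUnit (θ s)) (g : B →+* C) :
    Spec.map (CommRingCat.ofHom g) ≫ projPoint 𝒜 hs hm θ hu =
      projPoint 𝒜 hs hm (g.comp θ) (hu.map g) := by
  rw [projPoint, projPoint, ← Spec.map_comp_assoc, ← CommRingCat.ofHom_comp,
    awayLift_comp 𝒜 θ hu hs]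

theorem projPoint_eq {s t : A} {m m' : ℕ} (hs : s ∈ 𝒜 m) (hm : 0 < m) (ht : t ∈ 𝒜 m')
    (hm' : 0 < m') {B : Type u} [CommRing B] (θ : A →+* B)
    (hu : IsUnit (θ s)) (hu' : IsUnit (θ t)) :
    projPoint 𝒜 hs hm θ hu = projPoint 𝒜 ht hm' θ hu' := by
  have h1 : IsUnit (θ (s * t)) := by rw [map_mul]; exact hu.mul hu'
  have h2 : IsUnit (θ (t * s)) := by rw [map_mul]; exact hu'.mul hu
  have key {s t : A} {m m' : ℕ} (hs : s ∈ 𝒜 m) (hm : 0 < m) (ht : t ∈ 𝒜 m')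
      (hu : IsUnit (θ s)) (h1 : IsUnit (θ (s * t))) : projPoint 𝒜 hs hm θ hu =
        projPoint 𝒜 (SetLike.mul_mem_graded hs ht) (hm.trans_le (m.le_add_right m')) θ h1 := by
    rw [projPoint, projPoint, ← awayLift_comp_awayMap 𝒜 θ h1 hu hs ht, CommRingCat.ofHom_comp,
      Spec.map_comp_assoc, Proj.SpecMap_awayMap_awayι]
  rw [key hs hm ht hu h1, key ht hm' hs hu' h2]
  congr 1
  · exact mul_comm _ _
  · exact add_comm _ _

theorem projPoint_map {A' σ' : Type u} [CommRing A'] [SetLike σ' A'] [AddSubgroupClass σ' A']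
    (ℬ : ℕ → σ') [GradedRing ℬ] (F : 𝒜 →+*ᵍ ℬ)
    (hF : HomogeneousIdeal.irrelevant ℬ ≤ (HomogeneousIdeal.irrelevant 𝒜).map F)
    {s : A} {m : ℕ} (hs : s ∈ 𝒜 m) (hm : 0 < m) {B : Type u} [CommRing B]
    (θ : A' →+* B) (hu : IsUnit (θ (F s))) (hu' : IsUnit (θ.comp (F : A →+* A') s))
    (hs' : F s ∈ ℬ m) :
    projPoint ℬ hs' hm θ hu ≫ Proj.map F hF =
      projPoint 𝒜 hs hm (θ.comp (F : A →+* A')) hu' := by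
  rw [projPoint, projPoint, Category.assoc, Proj.awayι_comp_map F hF hm s hs,
    ← Spec.map_comp_assoc, ← CommRingCat.ofHom_comp, awayLift_comp_map 𝒜 ℬ F θ hu hs]

theorem projPoint_toSpecZero {s : A} {m : ℕ} (hs : s ∈ 𝒜 m) (hm : 0 < m) {B : Type u}
    [CommRing B] (θ : A →+* B) (hu : IsUnit (θ s)) :
    projPoint 𝒜 hs hm θ hu ≫ Proj.toSpecZero 𝒜 =
      Spec.map (CommRingCat.ofHom (θ.comp (algebraMap (𝒜 0) A))) := by
  rw [projPoint, Category.assoc, Proj.awayι_toSpecZero, ← Spec.map_comp, ← CommRingCat.ofHom_comp]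
  congr 2
  ext x
  have := awayLift_mk 𝒜 θ hu hs 0 x (by simp)
  rw [pow_zero, mul_one] at this
  rw [RingHom.comp_apply, RingHom.comp_apply]
  change _ = θ x
  rw [← this]
  congr 1
  apply HomogeneousLocalization.val_injective
  rw [Away.val_mk]
  change Localization.mk _ _ = Localization.mk _ _
  congr 1
  simp

end ProjPoint

theorem basicOpen_eq_top_iff_isUnit {B : Type*} [CommRing B] {b : B} :
    PrimeSpectrum.basicOpen b = ⊤ ↔ IsUnit b := by
  rw [← top_le_iff, ← PrimeSpectrum.basicOpen_one, PrimeSpectrum.basicOpen_le_basicOpen_iff,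
    ← Ideal.eq_top_iff_one, Ideal.radical_eq_top, Ideal.span_singleton_eq_top]

theorem val_awayMk_mul_pow {A σ : Type*} [CommRing A] [SetLike σ A] [AddSubgroupClass σ A]
    (𝒜 : ℕ → σ) [GradedRing 𝒜] {s : A} {m : ℕ} (hs : s ∈ 𝒜 m) (n : ℕ) (a : A)
    (ha : a ∈ 𝒜 (n • m)) :
    (Away.mk 𝒜 hs n a ha).val * algebraMap A (Localization.Away s) s ^ n =
      algebraMap A (Localization.Away s) a := by
  rw [Away.val_mk, Localization.mk_eq_mk'_apply, ← map_pow]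
  exact IsLocalization.mk'_spec _ _ _

section ProjPoint
variable {A σ : Type u} [CommRing A] [SetLike σ A] [AddSubgroupClass σ A] (𝒜 : ℕ → σ)
  [GradedRing 𝒜]

theorem projPoint_preimage_basicOpen {s t : A} {m m' : ℕ} (hs : s ∈ 𝒜 m) (hm : 0 < m)
    (ht : t ∈ 𝒜 m') (hm' : 0 < m') {B : Type u} [CommRing B] (θ : A →+* B) (hu : IsUnit (θ s)) :
    projPoint 𝒜 hs hm θ hu ⁻¹ᵁ Proj.basicOpen 𝒜 t = PrimeSpectrum.basicOpen (θ t) := by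
  rw [projPoint, Scheme.Hom.comp_preimage, Proj.awayι_preimage_basicOpen 𝒜 hs hm ht hm']
  have h1 : awayLift 𝒜 θ hu (Away.isLocalizationElem hs ht) * θ s ^ m' = θ t ^ m := by
    rw [← map_pow θ t]
    exact awayLift_mk 𝒜 θ hu hs _ _ _
  refine (PrimeSpectrum.comap_basicOpen (awayLift 𝒜 θ hu) (Away.isLocalizationElem hs ht)).trans ?_
  rw [← PrimeSpectrum.basicOpen_pow (θ t) m hm, ← h1, PrimeSpectrum.basicOpen_mul,
    PrimeSpectrum.basicOpen_pow _ _ hm', basicOpen_eq_top_iff_isUnit.mpr hu, inf_top_eq]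

theorem mul_eq_mul_of_projPoint_eq {s t : A} {m m' : ℕ} (hs : s ∈ 𝒜 m) (hm : 0 < m)
    (ht : t ∈ 𝒜 m') (hm' : 0 < m') {B : Type u} [CommRing B] (θ θ' : A →+* B) (hu : IsUnit (θ s))
    (hu' : IsUnit (θ' t)) (h : projPoint 𝒜 hs hm θ hu = projPoint 𝒜 ht hm' θ' hu')
    {a b : A} (ha : a ∈ 𝒜 m) (hb : b ∈ 𝒜 m) : θ a * θ' b = θ b * θ' a := by
  have hu2 : IsUnit (θ' s) := by
    have h1 := congrArg (fun g ↦ g ⁻¹ᵁ Proj.basicOpen 𝒜 s) h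
    rw [projPoint_preimage_basicOpen 𝒜 hs hm hs hm, projPoint_preimage_basicOpen 𝒜 ht hm' hs hm,
      basicOpen_eq_top_iff_isUnit.mpr hu] at h1
    exact basicOpen_eq_top_iff_isUnit.mp h1.symm
  rw [projPoint_eq 𝒜 ht hm' hs hm θ' hu' hu2, projPoint, projPoint, cancel_mono] at h
  have h2 := congrArg CommRingCat.Hom.hom (Spec.map_injective h)
  simp only [CommRingCat.hom_ofHom] at h2
  have key (x) (hx : x ∈ 𝒜 m) : θ x * θ' s = θ' x * θ s := by
    have h3 := awayLift_mk 𝒜 θ hu hs 1 x (by simpa)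
    have h4 := awayLift_mk 𝒜 θ' hu2 hs 1 x (by simpa)
    rw [h2] at h3
    rw [← h3, ← h4]; ring
  refine (hu.mul hu2).mul_left_injective ?_
  dsimp only
  linear_combination θ s * θ' b * key a ha - θ s * θ' a * key b hb

end ProjPoint

/-- The grading on the polynomial ring. -/
abbrev polyGrading (n : ℕ) (R : Type u) [CommRing R] :=
  MvPolynomial.homogeneousSubmodule (Fin (n + 1)) R

section
variable {n : ℕ} {R : Type u} [CommRing R]
open MvPolynomial

theorem X_mem_polyGrading (i : Fin (n + 1)) :
    (X i : MvPolynomial (Fin (n + 1)) R) ∈ polyGrading n R 1 := isHomogeneous_X R i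

theorem C_mem_polyGrading (r : R) :
    (C r : MvPolynomial (Fin (n + 1)) R) ∈ polyGrading n R 0 := isHomogeneous_C _ r

/-- The constants in a chart of projective space. -/
def chartC (n : ℕ) (R : Type u) [CommRing R] (i : Fin (n + 1)) :
    R →+* Away (polyGrading n R) (X i : MvPolynomial (Fin (n + 1)) R) :=
  (fromZeroRingHom (polyGrading n R) _).comp (algebraMap R (polyGrading n R 0))

/-- The coordinate functions in a chart of projective space. -/
def chartX (R : Type u) [CommRing R] (i j : Fin (n + 1)) :
    Away (polyGrading n R) (X i : MvPolynomial (Fin (n + 1)) R) :=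
  Away.mk (polyGrading n R) (X_mem_polyGrading i) 1 (X j)
    (by simpa only [one_smul] using X_mem_polyGrading j)

theorem eval₂_mul_pow_of_isHomogeneous {σ R B : Type*} [CommSemiring R] [CommSemiring B]
    {a : MvPolynomial σ R} {m : ℕ} (ha : a.IsHomogeneous m) (f : R →+* B) (g : σ → B) (u : B) :
    eval₂ f g a * u ^ m = eval₂ f (fun j ↦ g j * u) a := by
  rw [eval₂_eq, eval₂_eq, Finset.sum_mul]
  refine Finset.sum_congr rfl fun d hd ↦ ?_
  simp_rw [mul_pow, Finset.prod_mul_distrib, ← mul_assoc]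
  congr 1
  rw [Finset.prod_pow_eq_pow_sum, ha.degree_eq_sum_deg_support hd]

theorem away_mk_eq_eval₂ (i : Fin (n + 1)) (m : ℕ) (a : MvPolynomial (Fin (n + 1)) R)
    (ha : a ∈ polyGrading n R (m • 1)) :
    Away.mk (polyGrading n R) (X_mem_polyGrading i) m a ha =
      eval₂ (chartC n R i) (chartX R i) a := by
  apply HomogeneousLocalization.val_injective
  rw [← HomogeneousLocalization.algebraMap_apply (eval₂ _ _ _), hom_eval₂]
  have hu : IsUnit (algebraMap _ (Localization.Away (X i : MvPolynomial (Fin (n + 1)) R)) (X i)) :=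
    IsLocalization.Away.algebraMap_isUnit (X i : MvPolynomial (Fin (n + 1)) R)
  refine (hu.pow m).mul_left_injective ?_
  dsimp only
  rw [val_awayMk_mul_pow, eval₂_mul_pow_of_isHomogeneous (show a.IsHomogeneous m by simpa using ha)]
  have h1 : (fun j ↦ (algebraMap (Away (polyGrading n R) (X i : MvPolynomial (Fin (n + 1)) R))
      (Localization.Away (X i : MvPolynomial (Fin (n + 1)) R)) ∘ chartX R i) j *
        algebraMap (MvPolynomial (Fin (n + 1)) R)
        (Localization.Away (X i : MvPolynomial (Fin (n + 1)) R)) (X i))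
      = fun j ↦ algebraMap (MvPolynomial (Fin (n + 1)) R)
        (Localization.Away (X i : MvPolynomial (Fin (n + 1)) R)) (X j) := by
    ext j
    rw [Function.comp_apply, HomogeneousLocalization.algebraMap_apply, chartX]
    have := val_awayMk_mul_pow (polyGrading n R) (X_mem_polyGrading i) 1 (X j)
      (by simpa only [one_smul] using X_mem_polyGrading j)
    rwa [pow_one] at this
  have h2 : (algebraMap (Away (polyGrading n R) (X i : MvPolynomial (Fin (n + 1)) R))
      (Localization.Away (X i : MvPolynomial (Fin (n + 1)) R))).comp (chartC n R i) =
      (algebraMap (MvPolynomial (Fin (n + 1)) R)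
        (Localization.Away (X i : MvPolynomial (Fin (n + 1)) R))).comp C := by
    ext r
    rfl
  refine Eq.trans ?_ (congrArg₂ (fun f g ↦ eval₂ f g a) h2 h1).symm
  rw [← hom_eval₂, eval₂_eta]

theorem chart_hom_ext {i : Fin (n + 1)} {B : Type*} [CommRing B]
    {α β : Away (polyGrading n R) (X i : MvPolynomial (Fin (n + 1)) R) →+* B}
    (hC : α.comp (chartC n R i) = β.comp (chartC n R i))
    (hX : ∀ j, α (chartX R i j) = β (chartX R i j)) : α = β := by
  ext x
  obtain ⟨m, a, ha, rfl⟩ := Away.mk_surjective _ (X_mem_polyGrading i) x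
  rw [away_mk_eq_eval₂, hom_eval₂, hom_eval₂, hC]
  congr 1
  exact funext hX

theorem awayLift_chartC {i : Fin (n + 1)} {B : Type*} [CommRing B]
    (θ : MvPolynomial (Fin (n + 1)) R →+* B) (hu : IsUnit (θ (X i))) :
    (awayLift (polyGrading n R) θ hu).comp (chartC n R i) = θ.comp C := by
  ext r
  have := awayLift_mk (polyGrading n R) θ hu (X_mem_polyGrading i) 0 (C r)
    (by simpa only [zero_smul] using C_mem_polyGrading r)
  rw [pow_zero, mul_one] at this
  rw [RingHom.comp_apply, RingHom.comp_apply, ← this]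
  congr 1

theorem awayLift_chartX {i : Fin (n + 1)} {B : Type*} [CommRing B]
    (θ : MvPolynomial (Fin (n + 1)) R →+* B) (hu : IsUnit (θ (X i))) (j) :
    (awayLift (polyGrading n R) θ hu) (chartX R i j) * θ (X i) = θ (X j) := by
  have := awayLift_mk (polyGrading n R) θ hu (X_mem_polyGrading i) 1 (X j)
    (by simpa only [one_smul] using X_mem_polyGrading j)
  rwa [pow_one] at this

theorem exists_awayLift_eq {i : Fin (n + 1)} {B : Type*} [CommRing B]
    (α : Away (polyGrading n R) (X i : MvPolynomial (Fin (n + 1)) R) →+* B) :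
    ∃ (θ : MvPolynomial (Fin (n + 1)) R →+* B) (hu : IsUnit (θ (X i))), θ (X i) = 1 ∧
      awayLift (polyGrading n R) θ hu = α := by
  have h1 : chartX R i i = 1 := by
    apply HomogeneousLocalization.val_injective
    have hu := IsLocalization.Away.algebraMap_isUnit
      (S := Localization.Away (X i : MvPolynomial (Fin (n + 1)) R))
      (X i : MvPolynomial (Fin (n + 1)) R)
    refine hu.mul_left_injective ?_
    have := val_awayMk_mul_pow (polyGrading n R) (X_mem_polyGrading i) 1 (X i)
      (by simpa only [one_smul] using X_mem_polyGrading i)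
    rw [pow_one] at this
    dsimp only
    rw [HomogeneousLocalization.val_one, one_mul]
    exact this
  have h : eval₂Hom (α.comp (chartC n R i)) (fun j ↦ α (chartX R i j)) (X i) = 1 := by simp [h1]
  refine ⟨_, h ▸ isUnit_one, h, chart_hom_ext ?_ fun j ↦ ?_⟩
  · rw [awayLift_chartC]; ext; simp
  · have := awayLift_chartX _ (h ▸ isUnit_one) j
    rw [show ∀ x : B, x * eval₂Hom (α.comp (chartC n R i)) (fun j ↦ α (chartX R i j)) (X i) = x from
      fun x ↦ by rw [h, mul_one]] at this
    rw [this]; simp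

/-- A point of projective space with given homogeneous coordinates. -/
def ProjectiveSpace.point {B : Type u} [CommRing B] (θ : MvPolynomial (Fin (n + 1)) R →+* B)
    (i : Fin (n + 1)) (hu : IsUnit (θ (X i))) : Spec (.of B) ⟶ ProjectiveSpace R n :=
  projPoint (polyGrading n R) (X_mem_polyGrading i) one_pos θ hu

namespace ProjectiveSpace

variable {B : Type u} [CommRing B] (θ θ' : MvPolynomial (Fin (n + 1)) R →+* B)
    {i i' : Fin (n + 1)} (hu : IsUnit (θ (X i))) (hu' : IsUnit (θ' (X i')))

theorem point_toSpec :
    point θ i hu ≫ toSpec R n = Spec.map (CommRingCat.ofHom (θ.comp C)) := by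
  rw [point, toSpec]
  erw [reassoc_of% projPoint_toSpecZero]
  rw [← Spec.map_comp, ← CommRingCat.ofHom_comp]
  rfl

theorem point_eq_point (i i' : Fin (n + 1)) (hu : IsUnit (θ (X i))) (hu' : IsUnit (θ (X i'))) :
    point θ i hu = point θ i' hu' :=
  projPoint_eq _ _ _ _ _ _ _ _

theorem SpecMap_point {B' : Type u} [CommRing B'] (g : B →+* B') :
    Spec.map (CommRingCat.ofHom g) ≫ point θ i hu = point (g.comp θ) i (hu.map g) :=
  SpecMap_projPoint _ _ _ _ _ _

theorem point_congr (u : B) (hc : θ'.comp C = θ.comp C)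
    (h : ∀ j, θ' (X j) = u * θ (X j)) : point θ i hu = point θ' i' hu' := by
  have h1 : IsUnit (θ (X i')) := isUnit_of_mul_isUnit_right (x := u) (by rw [← h]; exact hu')
  rw [point_eq_point θ i i' hu h1]
  unfold point projPoint
  congr 3
  refine chart_hom_ext ?_ fun j ↦ ?_
  · rw [awayLift_chartC, awayLift_chartC, hc]
  · refine hu'.mul_left_injective ?_
    dsimp only
    rw [awayLift_chartX, h, mul_left_comm, awayLift_chartX, h]

theorem mul_eq_mul_of_point_eq (h : point θ i hu = point θ' i' hu') (j l : Fin (n + 1)) :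
    θ (X j) * θ' (X l) = θ (X l) * θ' (X j) :=
  mul_eq_mul_of_projPoint_eq _ _ _ _ _ _ _ _ _ h (isHomogeneous_X R j) (isHomogeneous_X R l)

theorem iSup_basicOpen_X : ⨆ i, Proj.basicOpen (polyGrading n R) (X i) = ⊤ := by
  refine Proj.iSup_basicOpen_eq_top' _ _ (fun i ↦ ⟨1, X_mem_polyGrading i⟩) ?_
  rw [eq_top_iff]
  rintro p -
  induction p using MvPolynomial.induction_on with
  | C r => exact Subalgebra.algebraMap_mem _ (⟨C r, C_mem_polyGrading r⟩ : polyGrading n R 0)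
  | add p q hp hq => exact add_mem hp hq
  | mul_X p i hp => exact mul_mem hp (Algebra.subset_adjoin ⟨i, rfl⟩)

theorem exists_eq_point [IsLocalRing B] (g : Spec (.of B) ⟶ ProjectiveSpace R n) :
    ∃ (i : Fin (n + 1)) (θ : MvPolynomial (Fin (n + 1)) R →+* B) (hu : IsUnit (θ (X i))),
      θ (X i) = 1 ∧ g = point θ i hu := by
  change Spec (.of B) ⟶ Proj (polyGrading n R) at g
  obtain ⟨i, hi⟩ := TopologicalSpace.Opens.mem_iSup.mp
    (iSup_basicOpen_X.ge (Set.mem_univ (g (IsLocalRing.closedPoint B))))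
  have h2 : Set.range g ⊆
      Set.range (Proj.awayι (polyGrading n R) (X i) (X_mem_polyGrading i) one_pos) := by
    have h3 : g ⁻¹ᵁ Proj.basicOpen (polyGrading n R) (X i) = ⊤ :=
      IsLocalRing.closed_point_mem_iff.mp hi
    rw [← Scheme.Hom.coe_opensRange (Proj.awayι (polyGrading n R) (X i) (X_mem_polyGrading i)
      one_pos),
      Proj.opensRange_awayι]
    rintro _ ⟨x, rfl⟩
    exact h3.ge (Set.mem_univ x)
  obtain ⟨α, hα⟩ := Spec.map_surjective (IsOpenImmersion.lift
    (Proj.awayι (polyGrading n R) (X i) (X_mem_polyGrading i) one_pos) g h2)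
  obtain ⟨θ, hu, hθ, hl⟩ := exists_awayLift_eq α.hom
  refine ⟨i, θ, hu, hθ, ?_⟩
  unfold point projPoint
  rw [hl, CommRingCat.ofHom_hom, hα]
  exact (IsOpenImmersion.lift_fac _ g h2).symm

end ProjectiveSpace
end

namespace ProjectiveSpace
open MvPolynomial

theorem comp_C_eq {R B : Type u} [CommRing R] [CommRing B] {n : ℕ}
    {ψ : ProjectiveSpace R n ⟶ ProjectiveSpace R n} {τ : R →+* R}
    (hψ : ψ ≫ toSpec R n = toSpec R n ≫ Spec.map (CommRingCat.ofHom τ))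
    (θ θ' : MvPolynomial (Fin (n + 1)) R →+* B) {i i' : Fin (n + 1)}
    {hu : IsUnit (θ (X i))} {hu' : IsUnit (θ' (X i'))}
    (h : point θ i hu ≫ ψ = point θ' i' hu') : θ'.comp C = (θ.comp C).comp τ := by
  have h1 : point θ' i' hu' ≫ toSpec R n =
      point θ i hu ≫ toSpec R n ≫ Spec.map (CommRingCat.ofHom τ) := by
    rw [← h, Category.assoc, hψ]
  rw [reassoc_of% point_toSpec, point_toSpec, ← Spec.map_comp, ← CommRingCat.ofHom_comp] at h1
  exact congrArg CommRingCat.Hom.hom (Spec.map_injective h1)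

/-- The ring endomorphism `F` describes the endomorphism `ψ` of projective space in terms of
homogeneous coordinates. -/
structure Represents {K : Type u} [Field K] {n : ℕ} (τ : K →+* K)
    (F : MvPolynomial (Fin (n + 1)) K →+* MvPolynomial (Fin (n + 1)) K)
    (ψ : ProjectiveSpace K n ⟶ ProjectiveSpace K n) : Prop where
  map_toSpec : ψ ≫ toSpec K n = toSpec K n ≫ Spec.map (CommRingCat.ofHom τ)
  comp_C : F.comp C = C.comp τ
  dvd_of_dvd_mul : ∀ a b, (∀ j, a ∣ b * F (X j)) → a ∣ b
  generic (i hu j hu') :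
    point (algebraMap _ (FractionRing (MvPolynomial (Fin (n + 1)) K))) i hu ≫ ψ =
    point ((algebraMap _ (FractionRing (MvPolynomial (Fin (n + 1)) K))).comp F) j hu'

variable {K : Type u} [Field K] {n : ℕ}

theorem exists_represents (ψ : ProjectiveSpace K n ⟶ ProjectiveSpace K n) (τ : K →+* K)
    (hψ : ψ ≫ toSpec K n = toSpec K n ≫ Spec.map (CommRingCat.ofHom τ)) :
    ∃ F, Represents τ F ψ := by
  set S := MvPolynomial (Fin (n + 1)) K
  set ι := algebraMap S (FractionRing S)
  have hι : Function.Injective ι := IsFractionRing.injective _ _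
  have hu0 (i : Fin (n + 1)) : IsUnit (ι (X i)) :=
    (((map_ne_zero_iff ι hι).mpr (X_ne_zero i))).isUnit
  obtain ⟨i, θ, hu, hθ, h⟩ := exists_eq_point (point ι 0 (hu0 0) ≫ ψ)
  have hC := comp_C_eq hψ _ _ h
  obtain ⟨b, hb⟩ := IsLocalization.exist_integer_multiples_of_finite (nonZeroDivisors S)
    (fun j ↦ θ (X j))
  choose g hg using hb
  obtain ⟨hN⟩ : Nonempty (NormalizedGCDMonoid S) := inferInstance
  obtain ⟨f, hf, hf1⟩ := Finset.extract_gcd g (Finset.univ_nonempty (α := Fin (n + 1)))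
  set d := Finset.univ.gcd g
  have hb0 : (b : S) ≠ 0 := nonZeroDivisors.coe_ne_zero b
  have hd0 : d ≠ 0 := by
    intro hd
    have h1 := hf i (Finset.mem_univ _)
    have h2 := hg i
    rw [h1, hd, zero_mul, map_zero, hθ, Algebra.smul_def, mul_one] at h2
    exact hb0 (hι (by rw [map_zero]; exact h2.symm))
  have key (j) : ι (f j) = (ι b / ι d) * θ (X j) := by
    have := (hg j).trans (Algebra.smul_def _ _)
    rw [hf j (Finset.mem_univ _), map_mul] at this
    have h3 : ι d ≠ 0 := (map_ne_zero_iff ι hι).mpr hd0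
    rw [div_mul_eq_mul_div, eq_div_iff h3, mul_comm]
    exact this
  refine ⟨eval₂Hom (C.comp τ) f, hψ, by ext; simp, fun a b h ↦ ?_, fun i1 hu1 j1 hu1' ↦ ?_⟩
  · have h4 : a ∣ Finset.univ.gcd (fun j ↦ b * f j) := by
      refine Finset.dvd_gcd fun j _ ↦ ?_
      simpa using h j
    have h5 := Finset.gcd_mul_left' (s := Finset.univ) (f := f) b
    rw [hf1, mul_one] at h5
    exact h5.dvd_iff_dvd_right.mp h4
  · rw [point_eq_point ι i1 0 hu1 (hu0 0), h]
    refine point_congr _ _ _ _ (ι b / ι d) ?_ fun j ↦ ?_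
    · rw [hC]; ext; simp; rfl
    · rw [← key]; simp; rfl

namespace Represents
variable {τ : K →+* K} {F : MvPolynomial (Fin (n + 1)) K →+* MvPolynomial (Fin (n + 1)) K}
    {ψ : ProjectiveSpace K n ⟶ ProjectiveSpace K n}

theorem isUnit_of_dvd (h : Represents τ F ψ) {d} (hd : ∀ j, d ∣ F (X j)) : IsUnit d :=
  isUnit_of_dvd_one (h.dvd_of_dvd_mul d 1 (by simpa))

theorem exists_ne_zero (h : Represents τ F ψ) : ∃ j, F (X j) ≠ 0 := by
  by_contra! h0
  exact not_isUnit_zero (h.isUnit_of_dvd (d := 0) (by simp [h0]))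

theorem exists_point_localization (h : Represents τ F ψ)
    (p : Ideal (MvPolynomial (Fin (n + 1)) K)) [p.IsPrime] (i hu) :
    ∃ j hj, point (algebraMap _ (Localization.AtPrime p)) i hu ≫ ψ =
      point ((algebraMap _ (Localization.AtPrime p)).comp F) j hj := by
  set S := MvPolynomial (Fin (n + 1)) K
  set α := algebraMap S (Localization.AtPrime p)
  set ι := algebraMap S (FractionRing S)
  have hι : Function.Injective ι := IsFractionRing.injective _ _
  have hle : p.primeCompl ≤ nonZeroDivisors S := p.primeCompl_le_nonZeroDivisors
  have hinv (y : p.primeCompl) : IsUnit (ι y) :=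
    ((map_ne_zero_iff ι hι).mpr (nonZeroDivisors.ne_zero (hle y.2))).isUnit
  have hα : Function.Injective α := IsLocalization.injective _ hle
  let κ : Localization.AtPrime p →+* FractionRing S :=
    IsLocalization.lift (M := p.primeCompl) (g := ι) hinv
  have hκα : κ.comp α = ι := IsLocalization.lift_comp _
  have hκα' (x) : κ (α x) = ι x := DFunLike.congr_fun hκα x
  have hκ : Function.Injective κ := by
    refine (IsLocalization.lift_injective_iff (M := p.primeCompl) _).mpr fun x y ↦ ?_
    exact ⟨fun h ↦ by rw [hα h], fun h ↦ by rw [hι h]⟩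
  obtain ⟨i0, η, hη, hη1, h1⟩ := exists_eq_point (point α i hu ≫ ψ)
  have hC := comp_C_eq h.map_toSpec _ _ h1
  obtain ⟨j0, hj0⟩ := h.exists_ne_zero
  have hj0' : IsUnit ((ι.comp F) (X j0)) := ((map_ne_zero_iff ι hι).mpr hj0).isUnit
  have h2 : point (κ.comp η) i0 (hη.map κ) = point (ι.comp F) j0 hj0' := by
    rw [← SpecMap_point η hη κ, ← h1, reassoc_of% SpecMap_point α hu κ]
    have := h.generic i (hκα' _ ▸ hu.map κ) j0 hj0'
    rw [← this]
    congr 2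
  have h3 (j) : α (F (X j)) = α (F (X i0)) * η (X j) := by
    have := mul_eq_mul_of_point_eq _ _ _ _ h2 i0 j
    simp only [RingHom.comp_apply, hη1, map_one, one_mul] at this
    apply hκ
    rw [map_mul]
    simp only [hκα']
    rw [this]
    exact mul_comm _ _
  obtain ⟨s, hs⟩ := IsLocalization.exist_integer_multiples_of_finite p.primeCompl
    (fun j ↦ η (X j))
  choose t ht using hs
  have h4 : F (X i0) ∣ s := by
    refine h.dvd_of_dvd_mul _ _ fun j ↦ ⟨t j, hα ?_⟩
    rw [map_mul, map_mul, h3]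
    have := (ht j).trans (Algebra.smul_def _ _)
    change α (t j) = α s * _ at this
    rw [this]; ring
  have h5 : IsUnit ((α.comp F) (X i0)) := by
    refine isUnit_of_dvd_unit (map_dvd α h4) ?_
    exact IsLocalization.map_units (M := p.primeCompl) _ s
  refine ⟨i0, h5, h1.trans (point_congr _ _ _ _ (α (F (X i0))) ?_ h3)⟩
  rw [hC, RingHom.comp_assoc, h.comp_C, RingHom.comp_assoc]

theorem exists_point (h : Represents τ F ψ) {B : Type u} [CommRing B] [IsLocalRing B]
    (θ : MvPolynomial (Fin (n + 1)) K →+* B) (i hu) :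
    ∃ j hj, point θ i hu ≫ ψ = point (θ.comp F) j hj := by
  set p := (IsLocalRing.maximalIdeal B).comap θ
  have hp : p.IsPrime := inferInstance
  let α := algebraMap (MvPolynomial (Fin (n + 1)) K) (Localization.AtPrime p)
  have hinv (y : p.primeCompl) : IsUnit (θ y) := by
    have := y.2
    simpa [p, Ideal.primeCompl] using this
  let β : Localization.AtPrime p →+* B := IsLocalization.lift (M := p.primeCompl) (g := θ) hinv
  have hβ : β.comp α = θ := IsLocalization.lift_comp _
  have hu' : IsUnit (α (X i)) := by
    refine IsLocalization.map_units (M := p.primeCompl) _ ⟨X i, ?_⟩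
    simpa [p, Ideal.primeCompl] using hu
  obtain ⟨j, hj, h1⟩ := h.exists_point_localization p i hu'
  have h2 := congrArg (Spec.map (CommRingCat.ofHom β) ≫ ·) h1
  rw [SpecMap_point, ← Category.assoc, SpecMap_point] at h2
  simp only [← RingHom.comp_assoc] at h2
  have hj' : IsUnit ((θ.comp F) (X j)) := by
    rw [← hβ]; exact hj.map β
  refine ⟨j, hj', ?_⟩
  convert h2 using 1
  · congr 2; exact hβ.symm
  · congr 2; exact hβ.symm

end Represents
end ProjectiveSpace

theorem coeff_eval₂_C_mul_X {σ R : Type*} [CommSemiring R] (l : R) (p : MvPolynomial σ R)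
    (m : σ →₀ ℕ) :
    coeff m (eval₂ C (fun i ↦ C l * X i) p) = l ^ m.degree * coeff m p := by
  classical
  induction p using MvPolynomial.induction_on' with
  | monomial s a =>
    have h1 : eval₂ C (fun i ↦ C l * X i) (monomial s a) = monomial s (l ^ s.degree * a) := by
      rw [eval₂_monomial, Finsupp.prod]
      simp_rw [mul_pow, Finset.prod_mul_distrib]
      rw [Finset.prod_pow_eq_pow_sum, ← C_pow, monomial_eq (a := l ^ s.degree * a), C_mul,
        Finsupp.prod, ← mul_assoc, mul_comm (C a)]
      rfl
    rw [h1, coeff_monomial, coeff_monomial]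
    split_ifs with h
    · rw [h]
    · rw [mul_zero]
  | add p q hp hq => rw [eval₂_add, coeff_add, hp, hq, coeff_add, mul_add]

theorem eq_of_forall_pow_eq {K : Type*} [Field K] [Infinite K] {a b : ℕ}
    (h : ∀ l : K, l ≠ 0 → l ^ a = l ^ b) : a = b := by
  have h1 : (Polynomial.X ^ (a + 1) : Polynomial K) = Polynomial.X ^ (b + 1) := by
    refine Polynomial.funext fun l ↦ ?_
    rw [Polynomial.eval_pow, Polynomial.eval_pow, Polynomial.eval_X]
    rcases eq_or_ne l 0 with rfl | hl
    · simp
    · rw [pow_succ, pow_succ, h l hl]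
  simpa using congrArg Polynomial.natDegree h1

namespace ProjectiveSpace
variable {K : Type u} [Field K] {n : ℕ}
namespace Represents
variable {τ : K →+* K} {F : MvPolynomial (Fin (n + 1)) K →+* MvPolynomial (Fin (n + 1)) K}
    {ψ : ProjectiveSpace K n ⟶ ProjectiveSpace K n}
    {τ' : K →+* K} {F' : MvPolynomial (Fin (n + 1)) K →+* MvPolynomial (Fin (n + 1)) K}
    {ψ' : ProjectiveSpace K n ⟶ ProjectiveSpace K n}

theorem exists_isHomogeneous [Infinite K] (h : Represents τ F ψ) :
    ∃ d, ∀ i, (F (X i)).IsHomogeneous d := by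
  set ι := algebraMap (MvPolynomial (Fin (n + 1)) K) (FractionRing (MvPolynomial (Fin (n + 1)) K))
  have hι : Function.Injective ι := IsFractionRing.injective _ _
  obtain ⟨j0, hj0⟩ := h.exists_ne_zero
  have key (l : K) (hl : l ≠ 0) :
      ∃ u : K, ∀ i, eval₂ C (fun i ↦ C l * X i) (F (X i)) = C u * F (X i) := by
    let ev := eval₂Hom (C : K →+* MvPolynomial (Fin (n + 1)) K) (fun i ↦ C l * X i)
    have hev (i) : ev (X i) = C l * X i := by simp [ev]
    have hu : IsUnit ((ι.comp ev) (X 0)) := by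
      refine ((map_ne_zero_iff ι hι).mpr ?_).isUnit
      change ev (X 0) ≠ 0
      rw [hev]
      exact mul_ne_zero (C_ne_zero.mpr hl) (X_ne_zero _)
    have hu0 : IsUnit (ι (X 0)) := ((map_ne_zero_iff ι hι).mpr (X_ne_zero _)).isUnit
    have hj0' : IsUnit ((ι.comp F) (X j0)) := ((map_ne_zero_iff ι hι).mpr hj0).isUnit
    obtain ⟨j, hj, h1⟩ := h.exists_point (ι.comp ev) 0 hu
    have h2 : point ι 0 hu0 = point (ι.comp ev) 0 hu := by
      refine point_congr _ _ _ _ (ι (C l)) ?_ fun j ↦ ?_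
      · ext x; simp [ev]
      · rw [RingHom.comp_apply, hev, map_mul]
    rw [← h2, h.generic 0 hu0 j0 hj0'] at h1
    have h3 (i j) : F (X i) * ev (F (X j)) = F (X j) * ev (F (X i)) := by
      apply hι
      rw [map_mul, map_mul]
      exact mul_eq_mul_of_point_eq _ _ _ _ h1 i j
    obtain ⟨w, hw⟩ : F (X j0) ∣ ev (F (X j0)) :=
      h.dvd_of_dvd_mul _ _ fun j ↦ ⟨ev (F (X j)), by rw [h3, mul_comm]⟩
    have h4 : (ev (F (X j0))).totalDegree ≤ (F (X j0)).totalDegree := by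
      refine totalDegree_le_of_support_subset fun m hm ↦ ?_
      rw [mem_support_iff] at hm ⊢
      intro h0
      refine hm ((coeff_eval₂_C_mul_X l (F (X j0)) m).trans ?_)
      rw [h0, mul_zero]
    have h5 : w.totalDegree = 0 := by
      rcases eq_or_ne w 0 with rfl | hw0
      · simp
      · rw [hw, totalDegree_mul_of_isDomain hj0 hw0] at h4
        omega
    refine ⟨w.coeff 0, fun i ↦ ?_⟩
    rw [← totalDegree_eq_zero_iff_eq_C.mp h5]
    refine mul_left_cancel₀ hj0 ?_
    change _ * ev (F (X i)) = _
    rw [h3, hw]; ring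
  obtain ⟨m0, hm0⟩ := ne_zero_iff.mp hj0
  refine ⟨m0.degree, fun i ↦ ?_⟩
  intro m hm
  rw [show Finsupp.weight 1 m = m.degree from by
    rw [Finsupp.degree_eq_weight_one]; rfl]
  refine eq_of_forall_pow_eq (K := K) fun l hl ↦ ?_
  obtain ⟨u, hu⟩ := key l hl
  have h1 := congrArg (coeff m) (hu i)
  have h2 := congrArg (coeff m0) (hu j0)
  rw [coeff_eval₂_C_mul_X, coeff_C_mul] at h1 h2
  rw [mul_right_cancel₀ hm h1, mul_right_cancel₀ hm0 h2]

theorem exists_point_comp (h : Represents τ F ψ) (h' : Represents τ' F' ψ')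
    (hc : ψ ≫ ψ' = 𝟙 _) {B : Type u} [CommRing B] [IsLocalRing B]
    (θ : MvPolynomial (Fin (n + 1)) K →+* B) (i hu) :
    ∃ j hj, point θ i hu = point (θ.comp (F.comp F')) j hj := by
  obtain ⟨j, hj, h1⟩ := h.exists_point θ i hu
  obtain ⟨l, hl, h2⟩ := h'.exists_point (θ.comp F) j hj
  refine ⟨l, hl, ?_⟩
  rw [← h1, Category.assoc, hc, Category.comp_id] at h2
  exact h2

theorem exists_map_map_eq (h : Represents τ F ψ) (h' : Represents τ' F' ψ')
    (hn : n ≠ 0) (hc : ψ ≫ ψ' = 𝟙 _) :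
    ∃ c : K, c ≠ 0 ∧ ∀ i, F (F' (X i)) = C c * X i := by
  set S := MvPolynomial (Fin (n + 1)) K
  set ι := algebraMap S (FractionRing S)
  have hι : Function.Injective ι := IsFractionRing.injective _ _
  obtain ⟨i, hi⟩ : ∃ i : Fin (n + 1), i ≠ 0 := ⟨Fin.last n, by simpa [Fin.ext_iff] using hn⟩
  have hnd : ¬ (X 0 : S) ∣ X i := fun h0 ↦ hi (X_dvd_X.mp h0).symm
  obtain ⟨l, hl, h1⟩ := exists_point_comp h h' hc ι 0
    ((map_ne_zero_iff ι hι).mpr (X_ne_zero _)).isUnit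
  have h2 (i j : Fin (n + 1)) : X i * F (F' (X j)) = X j * F (F' (X i)) := by
    apply hι
    rw [map_mul, map_mul]
    exact mul_eq_mul_of_point_eq _ _ _ _ h1 i j
  obtain ⟨c, hc1⟩ : (X 0 : S) ∣ F (F' (X 0)) := by
    refine ((X_prime (R := K)).dvd_or_dvd ⟨F (F' (X i)), (h2 i 0)⟩).resolve_left hnd
  have h3 (j) : F (F' (X j)) = c * X j := by
    refine mul_left_cancel₀ (X_ne_zero (R := K) (0 : Fin (n + 1))) ?_
    rw [h2, hc1]; ring
  have hc0 : c ≠ 0 := by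
    rintro rfl
    simp [h3] at hl
  have hu : IsUnit c := by
    by_contra hcu
    obtain ⟨π, hπ, hd⟩ := WfDvdMonoid.exists_irreducible_factor hcu hc0
    have hπ' := hπ.prime
    have hp : (Ideal.span {π}).IsPrime := (Ideal.span_singleton_prime hπ.ne_zero).mpr hπ'
    obtain ⟨a, ha⟩ : ∃ a : Fin (n + 1), ¬ π ∣ X a := by
      by_contra! hall
      have h01 := (hπ.associated_of_dvd (X_prime (R := K)).irreducible (hall 0)).symm.dvd
      exact hnd (h01.trans (hall i))
    set α := algebraMap S (Localization.AtPrime (Ideal.span {π}))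
    have hα (x : S) : IsUnit (α x) ↔ ¬ π ∣ x := by
      rw [IsLocalization.AtPrime.isUnit_to_map_iff _ (Ideal.span {π}), Ideal.mem_primeCompl_iff,
        Ideal.mem_span_singleton]
    obtain ⟨l, hl, -⟩ := exists_point_comp h h' hc α a ((hα _).mpr ha)
    refine (hα _).mp hl ?_
    change π ∣ F (F' (X l))
    rw [h3]
    exact hd.mul_right _
  obtain ⟨c0, hc2, rfl⟩ := isUnit_iff_eq_C_of_isReduced.mp hu
  exact ⟨c0, hc2.ne_zero, h3⟩

end Represents

theorem exists_linear_represents [Infinite K] (ψ : ProjectiveSpace K n ≅ ProjectiveSpace K n)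
    (τ : K ≃+* K)
    (hψ : ψ.hom ≫ toSpec K n = toSpec K n ≫ Spec.map (CommRingCat.ofHom (τ : K →+* K))) :
    ∃ F : MvPolynomial (Fin (n + 1)) K →+* MvPolynomial (Fin (n + 1)) K,
      (∀ i hu j hu', point (algebraMap _ (FractionRing (MvPolynomial (Fin (n + 1)) K))) i hu ≫
        ψ.hom = point ((algebraMap _ (FractionRing (MvPolynomial (Fin (n + 1)) K))).comp F) j hu') ∧
      F.comp C = C.comp (τ : K →+* K) ∧ (∀ i, F (X i) ∈ polyGrading n K 1) ∧
      (∀ i, ∃ y ∈ polyGrading n K 1, F y = X i) ∧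
      Set.InjOn F (polyGrading n K 1) := by
  obtain ⟨F, hF⟩ := exists_represents ψ.hom (τ : K →+* K) hψ
  by_cases hn : n = 0
  · subst hn
    refine ⟨MvPolynomial.map τ, fun i hu j hu' ↦ ?_, by ext; simp,
      fun i ↦ ?_, fun i ↦ ⟨X i, X_mem_polyGrading i, by simp⟩, ?_⟩
    · obtain ⟨l, hl, h1⟩ := hF.exists_point _ i hu
      rw [h1]
      have hu1 := hl
      have : Subsingleton (Fin (0 + 1)) := inferInstanceAs (Subsingleton (Fin 1))
      rw [Subsingleton.elim l i] at hu1
      refine point_congr _ _ _ _ (algebraMap (MvPolynomial (Fin (0 + 1)) K) _ (X i) * ↑hu1.unit⁻¹)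
        ?_ fun j ↦ ?_
      · rw [RingHom.comp_assoc, RingHom.comp_assoc, hF.comp_C]; congr 1; ext; simp
      · rw [Subsingleton.elim j i, mul_assoc, IsUnit.val_inv_mul, mul_one]
        simp
    · simpa using X_mem_polyGrading i
    · exact (map_injective _ τ.injective).injOn
  have hψ' : ψ.inv ≫ toSpec K n = toSpec K n ≫ Spec.map (CommRingCat.ofHom (τ.symm : K →+* K)) := by
    rw [Iso.inv_comp_eq, ← Category.assoc, hψ, Category.assoc, ← Spec.map_comp,
      ← CommRingCat.ofHom_comp]
    simp
  obtain ⟨F', hF'⟩ := exists_represents ψ.inv (τ.symm : K →+* K) hψ'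
  obtain ⟨c, hc, h1⟩ := hF.exists_map_map_eq hF' hn ψ.hom_inv_id
  obtain ⟨c', hc', h2⟩ := hF'.exists_map_map_eq hF hn ψ.inv_hom_id
  obtain ⟨d, hd⟩ := hF.exists_isHomogeneous
  obtain ⟨d', hd'⟩ := hF'.exists_isHomogeneous
  have hFC (x) : F (C x) = C (τ x) := DFunLike.congr_fun hF.comp_C x
  have hFC' (x) : F' (C x) = C (τ.symm x) := DFunLike.congr_fun hF'.comp_C x
  have hev (F : MvPolynomial (Fin (n + 1)) K →+* MvPolynomial (Fin (n + 1)) K) (p) :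
      F p = eval₂ (F.comp C) (fun i ↦ F (X i)) p := by
    rw [← hom_eval₂, eval₂_eta]
  have h3 : d * d' = 1 := by
    have h4 : (F (F' (X 0))).IsHomogeneous (d * d') := by
      rw [hev]
      refine (hd' 0).eval₂ _ _ (fun r ↦ ?_) hd
      rw [hF.comp_C]
      exact isHomogeneous_C _ _
    rw [h1] at h4
    refine h4.inj_right ?_ (mul_ne_zero (C_ne_zero.mpr hc) (X_ne_zero _))
    simpa using (isHomogeneous_C (Fin (n + 1)) c).mul (isHomogeneous_X K 0)
  obtain rfl : d = 1 := Nat.eq_one_of_mul_eq_one_right h3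
  obtain rfl : d' = 1 := Nat.eq_one_of_mul_eq_one_left h3
  refine ⟨F, hF.generic, hF.comp_C, hd, fun i ↦ ⟨C (τ.symm c⁻¹) * F' (X i), ?_, ?_⟩,
    fun x hx y hy hxy ↦ ?_⟩
  · change IsHomogeneous _ _
    simpa using (isHomogeneous_C (Fin (n + 1)) (τ.symm c⁻¹)).mul (hd' i)
  · rw [map_mul, h1, hFC, ← mul_assoc, ← C_mul]
    simp [hc]
  · have key (z) (hz : z ∈ polyGrading n K 1) : F' (F z) = C c' * z := by
      have h5 : z ∈
          Submodule.span K (Set.range (X : Fin (n + 1) → MvPolynomial (Fin (n + 1)) K)) := by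
        rw [← homogeneousSubmodule_one_eq_span_X]; exact hz
      clear hz
      induction h5 using Submodule.span_induction with
      | mem x hx => obtain ⟨i, rfl⟩ := hx; exact h2 i
      | zero => simp
      | add x y _ _ hx hy =>
        rw [map_add, map_add, hx, hy, mul_add]
      | smul a x _ hx =>
        rw [MvPolynomial.smul_eq_C_mul, map_mul, map_mul, hFC, hFC', hx, RingEquiv.symm_apply_apply]
        ring
    refine mul_left_cancel₀ (C_ne_zero.mpr hc') ?_
    rw [← key x hx, ← key y hy, hxy]

end ProjectiveSpace

theorem isIso_snd_lift_of_isPullback {C : Type*} [Category C] [HasPullbacks C]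
    {P' P Z' Z U V : C} {a : P' ⟶ P} {b : P' ⟶ Z'} {c : P ⟶ Z} {d : Z' ⟶ Z} (w : a ≫ c = b ≫ d)
    {f : U ⟶ P} {v : V ⟶ P'} {α : V ⟶ U} (h₁ : IsPullback v α a f)
    (h₂ : IsPullback α (v ≫ b) (f ≫ c) d) :
    IsIso (pullback.snd (pullback.lift a b w) (pullback.fst (pullback.fst c d) f)) := by
  have h : IsPullback (pullback.fst (pullback.fst c d) f) (pullback.snd (pullback.fst c d) f)
      (pullback.fst c d) f := IsPullback.of_hasPullback _ _
  have hW : IsPullback (pullback.fst (pullback.lift a b w) (pullback.fst (pullback.fst c d) f))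
      (pullback.snd (pullback.lift a b w) (pullback.fst (pullback.fst c d) f) ≫
        pullback.snd (pullback.fst c d) f) a f := by
    have := (IsPullback.of_hasPullback (pullback.lift a b w)
      (pullback.fst (pullback.fst c d) f)).flip.paste_horiz h.flip
    rw [pullback.lift_fst] at this
    exact this.flip
  have hZ : IsPullback (pullback.snd (pullback.fst c d) f)
      (pullback.fst (pullback.fst c d) f ≫ pullback.snd c d) (f ≫ c) d :=
    (h.paste_horiz (IsPullback.of_hasPullback c d).flip).flip
  have key : pullback.snd (pullback.lift a b w) (pullback.fst (pullback.fst c d) f) =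
      (hW.isoIsPullback _ _ h₁).hom ≫ (h₂.isoIsPullback _ _ hZ).hom := by
    apply hZ.hom_ext
    · rw [Category.assoc, IsPullback.isoIsPullback_hom_fst, IsPullback.isoIsPullback_hom_snd]
    · rw [Category.assoc, IsPullback.isoIsPullback_hom_snd, IsPullback.isoIsPullback_hom_fst_assoc,
        ← pullback.condition_assoc, pullback.lift_snd]
  rw [key]
  infer_instance

theorem isPullback_of_openCover {P' P Z' Z : Scheme.{u}} {a : P' ⟶ P} {b : P' ⟶ Z'} {c : P ⟶ Z}
    {d : Z' ⟶ Z} (w : a ≫ c = b ≫ d) (𝒰 : P.OpenCover) {V : 𝒰.I₀ → Scheme.{u}}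
    (v : ∀ i, V i ⟶ P') (α : ∀ i, V i ⟶ 𝒰.X i) (h₁ : ∀ i, IsPullback (v i) (α i) a (𝒰.f i))
    (h₂ : ∀ i, IsPullback (α i) (v i ≫ b) (𝒰.f i ≫ c) d) : IsPullback a b c d := by
  suffices IsIso (pullback.lift a b w) from
    IsPullback.of_iso_pullback ⟨w⟩ (asIso (pullback.lift a b w)) (pullback.lift_fst _ _ _)
      (pullback.lift_snd _ _ _)
  exact IsZariskiLocalAtTarget.of_openCover (P := MorphismProperty.isomorphisms Scheme)
    (𝒰.pullback₁ (pullback.fst c d)) fun i ↦ isIso_snd_lift_of_isPullback w (h₁ i) (h₂ i)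

namespace ProjectiveSpace

section
variable {R R' : Type u} [CommRing R] [CommRing R'] {n : ℕ}

theorem eq_eval₂ (F : MvPolynomial (Fin (n + 1)) R →+* MvPolynomial (Fin (n + 1)) R') (p) :
    F p = eval₂ (F.comp C) (fun i ↦ F (X i)) p := by
  rw [← hom_eval₂, eval₂_eta]

theorem mem_span_range_X_of_mem_polyGrading {m : ℕ} (hm : 0 < m) {p : MvPolynomial (Fin (n + 1)) R}
    (hp : p ∈ polyGrading n R m) :
    p ∈ Ideal.span (Set.range (X : Fin (n + 1) → MvPolynomial (Fin (n + 1)) R)) := by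
  rw [← Set.image_univ, mem_ideal_span_X_image]
  intro d hd
  have h : Finsupp.weight 1 d = m := hp (mem_support_iff.mp hd)
  by_contra! hd'
  have : d = 0 := Finsupp.ext fun i ↦ hd' i (Set.mem_univ i)
  subst this
  simp at h
  omega

/-- Ring homomorphisms between polynomial rings that are semilinear over a homomorphism of the
coefficient rings and map the variables to a generating set of linear forms. -/
structure IsLinear (τ : R →+* R')
    (F : MvPolynomial (Fin (n + 1)) R →+* MvPolynomial (Fin (n + 1)) R') : Prop where
  comp_C : F.comp C = C.comp τ
  map_X (i) : F (X i) ∈ polyGrading n R' 1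
  exists_eq_X (i) : ∃ y ∈ polyGrading n R 1, F y = X i

namespace IsLinear
variable {τ : R →+* R'} {F : MvPolynomial (Fin (n + 1)) R →+* MvPolynomial (Fin (n + 1)) R'}

/-- The graded ring homomorphism attached to a linear ring homomorphism. -/
def gradedHom (h : IsLinear τ F) : polyGrading n R →+*ᵍ polyGrading n R' where
  __ := F
  map_mem {m a} ha := by
    change (F a).IsHomogeneous m
    rw [eq_eval₂, ← one_mul m]
    refine IsHomogeneous.eval₂ ha _ _ (fun r ↦ ?_) h.map_X
    rw [h.comp_C]
    exact isHomogeneous_C _ _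

theorem irrelevant_le (h : IsLinear τ F) : HomogeneousIdeal.irrelevant (polyGrading n R') ≤
    (HomogeneousIdeal.irrelevant (polyGrading n R)).map h.gradedHom :=
  (HomogeneousIdeal.toIdeal_irrelevant_le _).mpr fun m hm p hp ↦
    Ideal.span_le.mpr (by
      rintro _ ⟨i, rfl⟩
      obtain ⟨y, hy, hyi⟩ := h.exists_eq_X i
      rw [← hyi]
      exact Ideal.mem_map_of_mem h.gradedHom (HomogeneousIdeal.mem_irrelevant_of_mem _ one_pos hy))
      (mem_span_range_X_of_mem_polyGrading hm hp)

/-- The morphism of projective spaces induced by a linear ring homomorphism. -/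
def map (h : IsLinear τ F) : ProjectiveSpace R' n ⟶ ProjectiveSpace R n :=
  Proj.map h.gradedHom h.irrelevant_le

theorem point_map (h : IsLinear τ F) {B : Type u} [CommRing B]
    (θ : MvPolynomial (Fin (n + 1)) R' →+* B) (i j)
    (hi : IsUnit (θ (X i))) (hj : IsUnit ((θ.comp F) (X j))) :
    point θ i hi ≫ h.map = point (θ.comp F) j hj := by
  obtain ⟨y, hy, hyi⟩ := h.exists_eq_X i
  have hu : IsUnit (θ (F y)) := by rwa [hyi]
  have hy' : F y ∈ polyGrading n R' 1 := hyi ▸ X_mem_polyGrading i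
  have h1 := projPoint_map (polyGrading n R) (polyGrading n R') h.gradedHom h.irrelevant_le hy
    one_pos θ hu hu hy'
  have h2 : point θ i hi = projPoint (polyGrading n R') hy' one_pos θ hu :=
    projPoint_eq _ _ _ _ _ _ _ _
  rw [h2]
  exact h1.trans (projPoint_eq (polyGrading n R) hy one_pos (X_mem_polyGrading j) one_pos
    (θ.comp F) hu hj)

theorem map_comp {R'' : Type u} [CommRing R''] {τ' : R' →+* R''} {τ'' : R →+* R''}
    {F' : MvPolynomial (Fin (n + 1)) R' →+* MvPolynomial (Fin (n + 1)) R''}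
    {F'' : MvPolynomial (Fin (n + 1)) R →+* MvPolynomial (Fin (n + 1)) R''} (h : IsLinear τ F)
    (h' : IsLinear τ' F') (h'' : IsLinear τ'' F'') (hF : F'.comp F = F'') :
    h'.map ≫ h.map = h''.map := by
  subst hF
  exact (Proj.map_comp _ _ _ _).symm

end IsLinear
end

section
variable {R R' : Type u} [CommRing R] [CommRing R'] {n : ℕ}

/-- The standard affine charts of projective space. -/
def chart (n : ℕ) (R : Type u) [CommRing R] (i : Fin (n + 1)) :
    Spec (.of (Away (polyGrading n R) (X i : MvPolynomial (Fin (n + 1)) R))) ⟶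
      ProjectiveSpace R n :=
  Proj.awayι (polyGrading n R) (X i) (X_mem_polyGrading i) one_pos

instance (i : Fin (n + 1)) : IsOpenImmersion (chart n R i) :=
  inferInstanceAs (IsOpenImmersion (Proj.awayι _ _ _ _))

theorem exists_chart_eq_point (i : Fin (n + 1)) :
    ∃ (θ : MvPolynomial (Fin (n + 1)) R →+*
        Away (polyGrading n R) (X i : MvPolynomial (Fin (n + 1)) R)) (hu : IsUnit (θ (X i))),
      chart n R i = point θ i hu ∧ θ.comp C = chartC n R i ∧ (∀ j, θ (X j) = chartX R i j) ∧
        θ (X i) = 1 := by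
  obtain ⟨θ, hu, h1, hθ⟩ := exists_awayLift_eq (RingHom.id
    (Away (polyGrading n R) (X i : MvPolynomial (Fin (n + 1)) R)))
  refine ⟨θ, hu, ?_, ?_, fun j ↦ ?_, h1⟩
  · rw [point, projPoint, hθ]
    simp only [CommRingCat.ofHom_id, Spec.map_id, Category.id_comp]
    rfl
  · rw [← awayLift_chartC θ hu, hθ, RingHom.id_comp]
  · rw [← awayLift_chartX θ hu, hθ, h1, mul_one, RingHom.id_apply]

theorem point_eq_chart {B : Type u} [CommRing B] (θ : MvPolynomial (Fin (n + 1)) R →+* B)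
    (i : Fin (n + 1)) (hu : IsUnit (θ (X i))) :
    point θ i hu =
      Spec.map (CommRingCat.ofHom (awayLift (polyGrading n R) θ hu)) ≫ chart n R i := rfl

theorem irrelevant_le_span_X : (HomogeneousIdeal.irrelevant (polyGrading n R)).toIdeal ≤
    Ideal.span (Set.range (X : Fin (n + 1) → MvPolynomial (Fin (n + 1)) R)) :=
  (HomogeneousIdeal.toIdeal_irrelevant_le _).mpr fun _ hm _ hp ↦
    mem_span_range_X_of_mem_polyGrading hm hp

/-- The cover of projective space by the standard affine charts. -/
def chartCover (n : ℕ) (R : Type u) [CommRing R] : (ProjectiveSpace R n).OpenCover :=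
  (Proj.affineOpenCoverOfIrrelevantLESpan (polyGrading n R)
    (fun i : ULift.{u} (Fin (n + 1)) ↦ (X i.down : MvPolynomial (Fin (n + 1)) R))
    (fun i ↦ X_mem_polyGrading i.down) (fun _ ↦ one_pos) (irrelevant_le_span_X.trans
      (Ideal.span_mono (by rintro _ ⟨i, rfl⟩; exact ⟨⟨i⟩, rfl⟩)))).openCover

theorem chart_hom_ext_left {Z : Scheme.{u}} {f g : ProjectiveSpace R n ⟶ Z}
    (h : ∀ i, chart n R i ≫ f = chart n R i ≫ g) : f = g :=
  (chartCover n R).hom_ext _ _ fun i ↦ h i.down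

theorem hom_ext_point {Z : Scheme.{u}} {f g : ProjectiveSpace R n ⟶ Z}
    (h : ∀ (B : Type u) [CommRing B] (θ : MvPolynomial (Fin (n + 1)) R →+* B) (i)
      (hu : IsUnit (θ (X i))), point θ i hu ≫ f = point θ i hu ≫ g) : f = g := by
  refine chart_hom_ext_left fun i ↦ ?_
  obtain ⟨θ, hu, h1, -⟩ := exists_chart_eq_point (R := R) i
  rw [h1, h]

theorem IsLinear.map_toSpec {τ : R →+* R'}
    {F : MvPolynomial (Fin (n + 1)) R →+* MvPolynomial (Fin (n + 1)) R'} (h : IsLinear τ F) :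
    h.map ≫ toSpec R n = toSpec R' n ≫ Spec.map (CommRingCat.ofHom τ) := by
  refine hom_ext_point fun B _ θ i hi ↦ ?_
  obtain ⟨y, hy, hyi⟩ := h.exists_eq_X i
  have hu : IsUnit (θ (F y)) := by rwa [hyi]
  have hy' : F y ∈ polyGrading n R' 1 := hyi ▸ X_mem_polyGrading i
  have h1 : point θ i hi ≫ h.map = _ :=
    (congrArg (· ≫ h.map) (projPoint_eq _ _ _ hy' one_pos θ hi hu)).trans
    (projPoint_map (polyGrading n R) (polyGrading n R') h.gradedHom h.irrelevant_le hy
    one_pos θ hu hu hy')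
  rw [reassoc_of% h1, reassoc_of% point_toSpec, ← Spec.map_comp, ← CommRingCat.ofHom_comp, toSpec]
  erw [reassoc_of% projPoint_toSpecZero]
  rw [← Spec.map_comp, ← CommRingCat.ofHom_comp]
  congr 2
  rw [RingHom.comp_assoc τ C θ, ← h.comp_C]
  rfl

theorem isLinear_map (g : R →+* R') :
    IsLinear (n := n) g (MvPolynomial.map g : MvPolynomial (Fin (n + 1)) R →+* _) where
  comp_C := by ext; simp
  map_X i := by rw [map_X]; exact X_mem_polyGrading i
  exists_eq_X i := ⟨X i, X_mem_polyGrading i, map_X _ _⟩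

/-- The base change morphism of projective spaces induced by a ring homomorphism. -/
def ofRingHom (n : ℕ) (g : R →+* R') : ProjectiveSpace R' n ⟶ ProjectiveSpace R n :=
  (isLinear_map g).map

theorem isPushout_chartC (g : R →+* R') {i : Fin (n + 1)}
    {α : Away (polyGrading n R) (X i : MvPolynomial (Fin (n + 1)) R) →+*
      Away (polyGrading n R') (X i : MvPolynomial (Fin (n + 1)) R')}
    (hC : α.comp (chartC n R i) = (chartC n R' i).comp g)
    (hX : ∀ j, α (chartX R i j) = chartX R' i j) :
    IsPushout (CommRingCat.ofHom (chartC n R i)) (CommRingCat.ofHom g) (CommRingCat.ofHom α)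
      (CommRingCat.ofHom (chartC n R' i)) := by
  have hdesc (B : CommRingCat.{u})
      (β : CommRingCat.of (Away (polyGrading n R) (X i : MvPolynomial (Fin (n + 1)) R)) ⟶ B)
      (γ : CommRingCat.of R' ⟶ B)
      (w : CommRingCat.ofHom (chartC n R i) ≫ β = CommRingCat.ofHom g ≫ γ) :
      ∃ δ : CommRingCat.of (Away (polyGrading n R') (X i : MvPolynomial (Fin (n + 1)) R')) ⟶ B,
        CommRingCat.ofHom α ≫ δ = β ∧ CommRingCat.ofHom (chartC n R' i) ≫ δ = γ := by
    obtain ⟨θ, hu, h1, hθ⟩ := exists_awayLift_eq β.hom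
    have hX1 : (eval₂Hom γ.hom (fun j ↦ θ (X j))) (X i) = 1 := by
      rw [eval₂Hom_X', h1]
    have hu' : IsUnit ((eval₂Hom γ.hom (fun j ↦ θ (X j))) (X i)) := hX1 ▸ isUnit_one
    have hγ : (awayLift (polyGrading n R') _ hu').comp (chartC n R' i) = γ.hom := by
      rw [awayLift_chartC]
      ext
      simp
    refine ⟨CommRingCat.ofHom (awayLift (polyGrading n R') _ hu'), CommRingCat.hom_ext ?_,
      CommRingCat.hom_ext hγ⟩
    refine chart_hom_ext ?_ fun j ↦ ?_
    · change ((awayLift (polyGrading n R') _ hu').comp α).comp _ = _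
      rw [RingHom.comp_assoc, hC, ← RingHom.comp_assoc, hγ]
      exact congrArg CommRingCat.Hom.hom w.symm
    · have h2 := awayLift_chartX _ hu' j
      have h3 := awayLift_chartX θ hu j
      rw [hX1, mul_one, eval₂Hom_X'] at h2
      rw [h1, mul_one, hθ] at h3
      change awayLift (polyGrading n R') _ hu' (α _) = _
      rw [hX, h2, h3]
  choose desc hl hr using hdesc
  refine ⟨⟨by rw [← CommRingCat.ofHom_comp, hC, CommRingCat.ofHom_comp]⟩,
    ⟨PushoutCocone.IsColimit.mk _ (fun s ↦ desc s.pt s.inl s.inr s.condition)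
      (fun s ↦ hl _ _ _ _) (fun s ↦ hr _ _ _ _) fun s m h1 h2 ↦ CommRingCat.hom_ext ?_⟩⟩
  refine chart_hom_ext (congrArg CommRingCat.Hom.hom (h2.trans (hr _ _ _ s.condition).symm))
    fun j ↦ ?_
  rw [← hX]
  exact congrArg (fun f ↦ f.hom (chartX R i j)) (h1.trans (hl _ _ _ s.condition).symm)

theorem isPullback_ofRingHom (g : R →+* R') :
    IsPullback (ofRingHom n g) (toSpec R' n) (toSpec R n) (Spec.map (CommRingCat.ofHom g)) := by
  have key (i : Fin (n + 1)) :
      ∃ α : Away (polyGrading n R) (X i : MvPolynomial (Fin (n + 1)) R) →+*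
        Away (polyGrading n R') (X i : MvPolynomial (Fin (n + 1)) R'),
        IsPullback (chart n R' i) (Spec.map (CommRingCat.ofHom α)) (ofRingHom n g)
          (chart n R i) ∧ IsPullback (Spec.map (CommRingCat.ofHom α)) (chart n R' i ≫ toSpec R' n)
          (chart n R i ≫ toSpec R n) (Spec.map (CommRingCat.ofHom g)) := by
    obtain ⟨θ, hu, h1, h2, h3, -⟩ := exists_chart_eq_point (R := R) i
    obtain ⟨θ', hu', h1', h2', h3', h4'⟩ := exists_chart_eq_point (R := R') i
    have hv : IsUnit ((θ'.comp (MvPolynomial.map g)) (X i)) := by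
      rwa [RingHom.comp_apply, map_X]
    refine ⟨awayLift (polyGrading n R) (θ'.comp (MvPolynomial.map g)) hv, ?_, ?_⟩
    · refine (IsOpenImmersion.isPullback _ _ _ _ ?_ ?_).flip
      · rw [← point_eq_chart, h1']
        exact ((isLinear_map g).point_map θ' i i hu' hv)
      · refine (congrArg (ofRingHom n g ⁻¹ᵁ ·) (Proj.opensRange_awayι _ _ _ _)).trans
          (Eq.trans ?_ (Proj.opensRange_awayι _ _ _ _).symm)
        change Proj.basicOpen _ (MvPolynomial.map g (X i)) = _
        rw [map_X]
    · rw [h1, h1', point_toSpec, point_toSpec, h2, h2']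
      refine isPullback_SpecMap_of_isPushout _ _ _ _ (isPushout_chartC g ?_ fun j ↦ ?_)
      · rw [awayLift_chartC, RingHom.comp_assoc, (isLinear_map g).comp_C, ← RingHom.comp_assoc, h2']
      · have := awayLift_chartX (θ'.comp (MvPolynomial.map g)) hv j
        simp only [RingHom.comp_apply, map_X, h4', mul_one] at this
        rw [← h3' j, ← this]
  choose α h₁ h₂ using key
  exact isPullback_of_openCover (isLinear_map g).map_toSpec (chartCover n R)
    (fun i ↦ chart n R' i.down) (fun i ↦ Spec.map (CommRingCat.ofHom (α i.down)))
    (fun i ↦ h₁ i.down) (fun i ↦ h₂ i.down)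

end

section
variable {n : ℕ}

theorem exists_chart_apply_eq {R : Type u} [CommRing R] (x : ProjectiveSpace R n) :
    ∃ i y, chart n R i y = x := by
  obtain ⟨i, y, h⟩ := (chartCover n R).exists_eq x
  exact ⟨i.down, y, h⟩

instance (R : Type u) [CommRing R] [_root_.IsReduced R] :
    AlgebraicGeometry.IsReduced (ProjectiveSpace R n) := by
  have (i : Fin (n + 1)) :
      _root_.IsReduced (Away (polyGrading n R) (X i : MvPolynomial (Fin (n + 1)) R)) := by
    exact isReduced_of_injective (algebraMap _ (Localization.Away
      (X i : MvPolynomial (Fin (n + 1)) R))) (HomogeneousLocalization.val_injective _)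
  have (i : ULift.{u} (Fin (n + 1))) : AlgebraicGeometry.IsReduced ((chartCover n R).X i) :=
    inferInstanceAs (AlgebraicGeometry.IsReduced (Spec (.of
      (Away (polyGrading n R) (X i.down : MvPolynomial (Fin (n + 1)) R)))))
  exact @IsReduced.of_openCover _ (chartCover n R) this

theorem isDominant_point {R B : Type u} [CommRing R] [CommRing B]
    (θ : MvPolynomial (Fin (n + 1)) R →+* B) (hθ : Function.Injective θ)
    (hu : ∀ i, IsUnit (θ (X i))) (i : Fin (n + 1)) : IsDominant (point θ i (hu i)) := by
  have h1 (j : Fin (n + 1)) : Function.Injective (awayLift (polyGrading n R) θ (hu j)) := by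
    rw [injective_iff_map_eq_zero]
    intro x hx
    obtain ⟨m, a, ha, rfl⟩ := Away.mk_surjective _ (X_mem_polyGrading j) x
    have h2 := awayLift_mk (polyGrading n R) θ (hu j) (X_mem_polyGrading j) m a ha
    rw [hx, zero_mul] at h2
    obtain rfl : a = 0 := hθ (h2.symm.trans (map_zero θ).symm)
    apply HomogeneousLocalization.val_injective
    rw [Away.val_mk, Localization.mk_zero, HomogeneousLocalization.val_zero]
  refine ⟨fun x ↦ ?_⟩
  obtain ⟨j, y, rfl⟩ := exists_chart_apply_eq x
  have h2 : DenseRange (Spec.map (CommRingCat.ofHom (awayLift (polyGrading n R) θ (hu j)))) :=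
    (PrimeSpectrum.denseRange_comap_iff_ker_le_nilRadical _).mpr (by
      exact ((RingHom.injective_iff_ker_eq_bot _).mp (h1 j)).trans_le bot_le)
  have h3 := image_closure_subset_closure_image (s := Set.range
    (Spec.map (CommRingCat.ofHom (awayLift (polyGrading n R) θ (hu j)))))
    (chart n R j).continuous ⟨y, h2 y, rfl⟩
  rw [point_eq_point θ i j (hu i) (hu j), point_eq_chart]
  rwa [← Set.range_comp, ← TopCat.coe_comp, ← Scheme.Hom.comp_base] at h3

end

end ProjectiveSpace

end

section
open TensorProduct

namespace schemeBaseChange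

section
variable {k R R' R'' : Type u} [CommRing k] [CommRing R] [CommRing R'] [CommRing R'']
  {P : Scheme.{u}} (sP : P ⟶ Spec (CommRingCat.of k))

/-- The projection from a base change to the original scheme. -/
def proj (f : k →+* R) : schemeBaseChange f sP ⟶ P := pullback.fst _ _

theorem isPullback_proj (f : k →+* R) :
    IsPullback (proj sP f) (toSpec f sP) sP (Spec.map (CommRingCat.ofHom f)) :=
  IsPullback.of_hasPullback _ _

variable {f : k →+* R} {f' : k →+* R'} {f'' : k →+* R''}

/-- The morphism between base changes induced by a homomorphism of algebras. -/
def map (u : R →+* R') (hu : u.comp f = f') : schemeBaseChange f' sP ⟶ schemeBaseChange f sP :=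
  (isPullback_proj sP f).lift (proj sP f') (toSpec f' sP ≫ Spec.map (CommRingCat.ofHom u)) (by
    rw [(isPullback_proj sP f').w, Category.assoc, ← Spec.map_comp, ← CommRingCat.ofHom_comp, hu])

theorem map_proj (u : R →+* R') (hu : u.comp f = f') : map sP u hu ≫ proj sP f = proj sP f' :=
  IsPullback.lift_fst _ _ _ _

theorem map_toSpec (u : R →+* R') (hu : u.comp f = f') :
    map sP u hu ≫ toSpec f sP = toSpec f' sP ≫ Spec.map (CommRingCat.ofHom u) :=
  IsPullback.lift_snd _ _ _ _

theorem isPullback_map (u : R →+* R') (hu : u.comp f = f') :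
    IsPullback (map sP u hu) (toSpec f' sP) (toSpec f sP) (Spec.map (CommRingCat.ofHom u)) := by
  refine IsPullback.of_right ?_ (map_toSpec sP u hu) (isPullback_proj sP f)
  rw [map_proj, ← Spec.map_comp, ← CommRingCat.ofHom_comp, hu]
  exact isPullback_proj sP f'

theorem map_comp_map (u : R →+* R') (hu : u.comp f = f') (u' : R' →+* R'')
    (hu' : u'.comp f' = f'') (v : R →+* R'') (hv : v.comp f = f'') (h : u'.comp u = v) :
    map sP u' hu' ≫ map sP u hu = map sP v hv := by
  apply (isPullback_proj sP f).hom_ext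
  · rw [Category.assoc, map_proj, map_proj, map_proj]
  · rw [Category.assoc, map_toSpec, map_toSpec, reassoc_of% map_toSpec sP u' hu', ← Spec.map_comp,
      ← CommRingCat.ofHom_comp, h]

theorem map_id (u : R →+* R) (hu : u.comp f = f) (h : u = RingHom.id R) :
    map sP u hu = 𝟙 _ := by
  apply (isPullback_proj sP f).hom_ext
  · rw [map_proj, Category.id_comp]
  · rw [map_toSpec, h, CommRingCat.ofHom_id, Spec.map_id, Category.comp_id, Category.id_comp]

end

section
variable {k K : Type u} [Field k] [Field K] [Algebra k K] {P : Scheme.{u}}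
  (sP : P ⟶ Spec (CommRingCat.of k))

/-- The action of an automorphism on the base change to a field extension. -/
def galois (σ : K ≃ₐ[k] K) :
    schemeBaseChange (algebraMap k K) sP ⟶ schemeBaseChange (algebraMap k K) sP :=
  map sP (σ : K →+* K) (AlgHom.comp_algebraMap (σ : K →ₐ[k] K))

theorem galois_mul (σ τ : K ≃ₐ[k] K) : galois sP (σ * τ) = galois sP σ ≫ galois sP τ :=
  (map_comp_map sP (τ : K →+* K) _ (σ : K →+* K) _ ((σ * τ : K ≃ₐ[k] K) : K →+* K) _
    (RingHom.ext fun _ ↦ rfl)).symm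

theorem galois_one : galois sP (1 : K ≃ₐ[k] K) = 𝟙 _ :=
  map_id sP _ _ rfl

theorem galois_pow_comp (σ : K ≃ₐ[k] K) {Q : Scheme.{u}}
    (h : schemeBaseChange (algebraMap k K) sP ⟶ Q) (hσ : galois sP σ ≫ h = h) (i : ℕ) :
    galois sP (σ ^ i) ≫ h = h := by
  induction i with
  | zero => rw [pow_zero, galois_one, Category.id_comp]
  | succ i ih => rw [pow_succ, galois_mul, Category.assoc, hσ, ih]

/-- The first projection from the self-product of the base change. -/
def selfFst : schemeBaseChange (algebraMap k (K ⊗[k] K)) sP ⟶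
    schemeBaseChange (algebraMap k K) sP :=
  map sP ((Algebra.TensorProduct.includeLeft : K →ₐ[k] K ⊗[k] K) : K →+* K ⊗[k] K)
    (AlgHom.comp_algebraMap _)

/-- The second projection from the self-product of the base change. -/
def selfSnd : schemeBaseChange (algebraMap k (K ⊗[k] K)) sP ⟶
    schemeBaseChange (algebraMap k K) sP :=
  map sP ((Algebra.TensorProduct.includeRight : K →ₐ[k] K ⊗[k] K) : K →+* K ⊗[k] K)
    (AlgHom.comp_algebraMap _)

theorem exists_lift_self {Z : Scheme.{u}} (g₁ g₂ : Z ⟶ schemeBaseChange (algebraMap k K) sP)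
    (h : g₁ ≫ proj sP _ = g₂ ≫ proj sP _) : ∃ g, g ≫ selfFst sP = g₁ ∧ g ≫ selfSnd sP = g₂ := by
  have hT := isPullback_SpecMap_of_isPushout _ _ _ _ (CommRingCat.isPushout_tensorProduct k K K)
  have h1 : (g₁ ≫ toSpec _ sP) ≫ Spec.map (CommRingCat.ofHom (algebraMap k K)) =
      (g₂ ≫ toSpec _ sP) ≫ Spec.map (CommRingCat.ofHom (algebraMap k K)) := by
    rw [Category.assoc, Category.assoc, ← (isPullback_proj sP _).w, reassoc_of% h]
  have h2 : (g₁ ≫ proj sP _) ≫ sP = hT.lift _ _ h1 ≫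
      Spec.map (CommRingCat.ofHom (algebraMap k (K ⊗[k] K))) := by
    rw [← AlgHom.comp_algebraMap (Algebra.TensorProduct.includeLeft : K →ₐ[k] K ⊗[k] K),
      CommRingCat.ofHom_comp, Spec.map_comp, Category.assoc, (isPullback_proj sP _).w]
    exact (Category.assoc _ _ _).symm.trans
      (congrArg (· ≫ Spec.map (CommRingCat.ofHom (algebraMap k K))) (hT.lift_fst _ _ h1).symm)
  refine ⟨(isPullback_proj sP _).lift _ _ h2, ?_, ?_⟩
  · apply (isPullback_proj sP _).hom_ext
    · rw [Category.assoc, selfFst, map_proj, IsPullback.lift_fst]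
    · rw [Category.assoc, selfFst, map_toSpec, IsPullback.lift_snd_assoc]
      exact hT.lift_fst _ _ h1
  · apply (isPullback_proj sP _).hom_ext
    · rw [Category.assoc, selfSnd, map_proj, IsPullback.lift_fst, h]
    · rw [Category.assoc, selfSnd, map_toSpec, IsPullback.lift_snd_assoc]
      exact hT.lift_snd _ _ h1

/-- The graph of a power of an automorphism. -/
def graph (σ : K ≃ₐ[k] K) (i : ℕ) : schemeBaseChange (algebraMap k K) sP ⟶
    schemeBaseChange (algebraMap k (K ⊗[k] K)) sP :=
  map sP (twistedMul σ i : K ⊗[k] K →+* K) (AlgHom.comp_algebraMap _)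

theorem graph_selfFst (σ : K ≃ₐ[k] K) (i : ℕ) : graph sP σ i ≫ selfFst sP = 𝟙 _ := by
  refine (map_comp_map sP _ _ _ _ (RingHom.id K) (RingHom.id_comp _) ?_).trans (map_id sP _ _ rfl)
  ext x
  exact (twistedMul_tmul σ i x 1).trans (by simp)

theorem graph_selfSnd (σ : K ≃ₐ[k] K) (i : ℕ) :
    graph sP σ i ≫ selfSnd sP = galois sP (σ ^ i) := by
  refine map_comp_map sP _ _ _ _ _ _ ?_
  ext x
  exact (twistedMul_tmul σ i 1 x).trans (by simp)

theorem exists_graph_mem (σ : K ≃ₐ[k] K) (hfix : ∀ x, σ x = x → x ∈ (algebraMap k K).range)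
    (U : (schemeBaseChange (algebraMap k (K ⊗[k] K)) sP).Opens)
    (hU : Set.Nonempty U.carrier) :
    ∃ i x, graph sP σ i x ∈ U := by
  have hopen : IsOpenMap (toSpec (algebraMap k (K ⊗[k] K)) sP) := by
    have : UniversallyOpen (toSpec (algebraMap k (K ⊗[k] K)) sP) :=
      MorphismProperty.of_isPullback (isPullback_proj sP _) inferInstance
    exact Scheme.Hom.isOpenMap _
  obtain ⟨w, hw⟩ := hU
  obtain ⟨_, ⟨t, rfl⟩, ht1, ht2⟩ :=
    PrimeSpectrum.isTopologicalBasis_basic_opens.exists_subset_of_mem_open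
    (Set.mem_image_of_mem _ hw) (hopen _ U.isOpen)
  have ht : t ≠ 0 := by
    rintro rfl
    simp only [PrimeSpectrum.basicOpen_zero] at ht1
    exact ht1
  obtain ⟨i, hi⟩ : ∃ i, twistedMul σ i t ≠ 0 := by
    by_contra! h
    exact ht (eq_zero_of_twistedMul σ hfix t h)
  let x : Spec (.of K) := (⊥ : PrimeSpectrum K)
  have hx : twistedMul σ i t ∉ (⊥ : PrimeSpectrum K).asIdeal := by
    rwa [PrimeSpectrum.asIdeal_bot, Ideal.mem_bot]
  obtain ⟨w', hw', hw''⟩ :=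
    ht2 (a := Spec.map (CommRingCat.ofHom (twistedMul σ i : K ⊗[k] K →+* K)) x) hx
  obtain ⟨a, ha, -⟩ := Scheme.exists_preimage_of_isPullback
    (isPullback_map sP (twistedMul σ i : K ⊗[k] K →+* K) (AlgHom.comp_algebraMap _)) w' x hw''
  exact ⟨i, a, by rw [graph]; exact ha ▸ hw'⟩

theorem selfFst_comp_eq_selfSnd_comp (σ : K ≃ₐ[k] K)
    (hfix : ∀ x, σ x = x → x ∈ (algebraMap k K).range)
    [AlgebraicGeometry.IsReduced (schemeBaseChange (algebraMap k (K ⊗[k] K)) sP)]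
    {Q : Scheme.{u}} [Q.IsSeparated] (h : schemeBaseChange (algebraMap k K) sP ⟶ Q)
    (hσ : galois sP σ ≫ h = h) : selfFst sP ≫ h = selfSnd sP ≫ h := by
  have hg (i : ℕ) : graph sP σ i ≫ selfFst sP ≫ h = graph sP σ i ≫ selfSnd sP ≫ h := by
    rw [reassoc_of% graph_selfFst, reassoc_of% graph_selfSnd, galois_pow_comp sP σ h hσ]
  have : IsDominant (equalizer.ι (selfFst sP ≫ h) (selfSnd sP ≫ h)) := by
    refine ⟨dense_iff_inter_open.mpr fun U hUo hU ↦ ?_⟩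
    obtain ⟨i, x, hx⟩ := exists_graph_mem sP σ hfix ⟨U, hUo⟩ hU
    refine ⟨_, hx, equalizer.lift (graph sP σ i) (hg i) x, ?_⟩
    rw [← Scheme.Hom.comp_apply, equalizer.lift_ι]
  exact ext_of_isDominant _ (equalizer.condition _ _)

theorem exists_descent (σ : K ≃ₐ[k] K)
    (hfix : ∀ x, σ x = x → x ∈ (algebraMap k K).range)
    [AlgebraicGeometry.IsReduced (schemeBaseChange (algebraMap k (K ⊗[k] K)) sP)]
    {Q : Scheme.{u}} [Q.IsSeparated] (h : schemeBaseChange (algebraMap k K) sP ⟶ Q)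
    (hσ : galois sP σ ≫ h = h) [EffectiveEpi (proj sP (algebraMap k K))] :
    ∃ f : P ⟶ Q, proj sP (algebraMap k K) ≫ f = h := by
  refine ⟨EffectiveEpi.desc (proj sP (algebraMap k K)) h fun {Z} g₁ g₂ hg ↦ ?_,
    EffectiveEpi.fac _ _ _⟩
  obtain ⟨g, rfl, rfl⟩ := exists_lift_self sP g₁ g₂ hg
  rw [Category.assoc, Category.assoc, selfFst_comp_eq_selfSnd_comp sP σ hfix h hσ]

end

end schemeBaseChange

end

section
open HomogeneousLocalization MvPolynomial TensorProduct

theorem surjective_flat_quasiCompact_specMap {k K : Type u} [Field k] [Field K] (f : k →+* K) :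
    (@Surjective ⊓ @Flat ⊓ @QuasiCompact : MorphismProperty Scheme.{u})
      (Spec.map (CommRingCat.ofHom f)) := by
  have h1 : Surjective (Spec.map (CommRingCat.ofHom f)) :=
    ⟨fun y ↦ ⟨(⊥ : PrimeSpectrum K), Subsingleton.elim (α := PrimeSpectrum k) _ _⟩⟩
  have h2 : Flat (Spec.map (CommRingCat.ofHom f)) := by
    rw [Flat.SpecMap_iff]
    algebraize [f]
    exact inferInstanceAs (Module.Flat k K)
  exact ⟨⟨h1, h2⟩, inferInstance⟩

theorem surjective_flat_quasiCompact_of_isPullback {k K : Type u} [Field k] [Field K]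
    {f : k →+* K} {Y Z : Scheme.{u}} {g : Y ⟶ Z} {b : Y ⟶ Spec (.of K)} {c : Z ⟶ Spec (.of k)}
    (h : IsPullback g b c (Spec.map (CommRingCat.ofHom f))) :
    (@Surjective ⊓ @Flat ⊓ @QuasiCompact : MorphismProperty Scheme.{u}) g :=
  have h1 := surjective_flat_quasiCompact_specMap f
  have := h1.1.1
  have := h1.1.2
  have := h1.2
  ⟨⟨MorphismProperty.of_isPullback (P := @Surjective) h.flip h1.1.1,
    MorphismProperty.of_isPullback (P := @Flat) h.flip h1.1.2⟩,
    MorphismProperty.of_isPullback (P := @QuasiCompact) h.flip h1.2⟩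

theorem effectiveEpi_of_isPullback {k K : Type u} [Field k] [Field K]
    {f : k →+* K} {Y Z : Scheme.{u}} {g : Y ⟶ Z} {b : Y ⟶ Spec (.of K)} {c : Z ⟶ Spec (.of k)}
    (h : IsPullback g b c (Spec.map (CommRingCat.ofHom f))) : EffectiveEpi g := by
  obtain ⟨⟨_, _⟩, _⟩ := surjective_flat_quasiCompact_of_isPullback h
  infer_instance

theorem isReduced_schemeBaseChange {k K T : Type u} [CommRing k] [CommRing K] [CommRing T]
    [_root_.IsReduced T] {f : k →+* K} (j : K →+* T) {f' : k →+* T} (hj : j.comp f = f')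
    {P : Scheme.{u}} {sP : P ⟶ Spec (CommRingCat.of k)} {n : ℕ}
    (e : schemeBaseChange f sP ≅ ProjectiveSpace K n)
    (he : e.hom ≫ ProjectiveSpace.toSpec K n = schemeBaseChange.toSpec f sP) :
    AlgebraicGeometry.IsReduced (schemeBaseChange f' sP) := by
  have h1 := schemeBaseChange.isPullback_map sP j hj
  have h2 : IsPullback e.hom (schemeBaseChange.toSpec f sP) (ProjectiveSpace.toSpec K n) (𝟙 _) :=
    IsPullback.of_horiz_isIso ⟨by rw [he, Category.comp_id]⟩
  have h3 := h1.paste_horiz h2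
  rw [Category.comp_id] at h3
  let i := h3.isoIsPullback _ _ (ProjectiveSpace.isPullback_ofRingHom (n := n) j)
  exact isReduced_of_isOpenImmersion i.hom

theorem exists_iso_of_galois_equivariant {k K : Type u} [Field k] [Field K] [Algebra k K]
    {P : Scheme.{u}} {sP : P ⟶ Spec (CommRingCat.of k)} {n : ℕ} (σ : K ≃ₐ[k] K)
    (hfix : ∀ x, σ x = x → x ∈ (algebraMap k K).range)
    (e : schemeBaseChange (algebraMap k K) sP ≅ ProjectiveSpace K n)
    (he : e.hom ≫ ProjectiveSpace.toSpec K n = schemeBaseChange.toSpec (algebraMap k K) sP)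
    (hσ : schemeBaseChange.galois sP σ ≫ e.hom ≫ ProjectiveSpace.ofRingHom n (algebraMap k K) =
      e.hom ≫ ProjectiveSpace.ofRingHom n (algebraMap k K)) :
    ∃ e : P ≅ ProjectiveSpace k n, e.hom ≫ ProjectiveSpace.toSpec k n = sP := by
  have := isReduced_tensorProduct_self σ hfix
  have : AlgebraicGeometry.IsReduced (schemeBaseChange (algebraMap k (K ⊗[k] K)) sP) :=
    isReduced_schemeBaseChange ((Algebra.TensorProduct.includeLeft : K →ₐ[k] K ⊗[k] K) :
      K →+* K ⊗[k] K) (AlgHom.comp_algebraMap _) e he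
  have hp := schemeBaseChange.isPullback_proj sP (algebraMap k K)
  have : EffectiveEpi (schemeBaseChange.proj sP (algebraMap k K)) := effectiveEpi_of_isPullback hp
  have hq := ProjectiveSpace.isPullback_ofRingHom (n := n) (algebraMap k K)
  have : (ProjectiveSpace k n).IsSeparated :=
    inferInstanceAs (Scheme.IsSeparated (Proj (polyGrading n k)))
  obtain ⟨f, hf⟩ := schemeBaseChange.exists_descent sP σ hfix _ hσ
  have hfs : f ≫ ProjectiveSpace.toSpec k n = sP := by
    rw [← cancel_epi (schemeBaseChange.proj sP (algebraMap k K)), reassoc_of% hf, hq.w,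
      reassoc_of% he, hp.w]
  have h1 : IsPullback e.hom (schemeBaseChange.proj sP (algebraMap k K))
      (ProjectiveSpace.ofRingHom n (algebraMap k K)) f := by
    refine (IsPullback.of_bot (h₂₁ := ProjectiveSpace.ofRingHom n (algebraMap k K)) ?_ hf hq).flip
    rw [he, hfs]
    exact hp
  have : IsIso f := (MorphismProperty.isomorphisms Scheme.{u}).of_isPullback_of_descendsAlong
    (Q := @Surjective ⊓ @Flat ⊓ @QuasiCompact) h1
    (surjective_flat_quasiCompact_of_isPullback hq) (inferInstanceAs (IsIso e.hom))
  exact ⟨asIso f, hfs⟩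

end

section
open HomogeneousLocalization MvPolynomial

namespace ProjectiveSpace

section
variable {K : Type u} [Field K] {n : ℕ}

/-- The variables as a basis of the space of linear forms. -/
def linearFormBasis (n : ℕ) (K : Type u) [Field K] :
    Module.Basis (Fin (n + 1)) K (polyGrading n K 1) :=
  (Module.Basis.span (linearIndependent_X (R := K) (σ := Fin (n + 1)))).map
    (LinearEquiv.ofEq _ _ homogeneousSubmodule_one_eq_span_X.symm)

theorem linearFormBasis_apply (i : Fin (n + 1)) :
    linearFormBasis n K i = ⟨X i, X_mem_polyGrading i⟩ := by
  ext1
  simp [linearFormBasis, Module.Basis.span_apply]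

/-- The substitution of variables given by a linear endomorphism of the space of linear forms. -/
def linearSubst (L : polyGrading n K 1 →ₗ[K] polyGrading n K 1) :
    MvPolynomial (Fin (n + 1)) K →ₐ[K] MvPolynomial (Fin (n + 1)) K :=
  aeval fun i ↦ (L ⟨X i, X_mem_polyGrading i⟩ : MvPolynomial (Fin (n + 1)) K)

theorem linearSubst_X (L : polyGrading n K 1 →ₗ[K] polyGrading n K 1) (i : Fin (n + 1)) :
    linearSubst L (X i) = L ⟨X i, X_mem_polyGrading i⟩ :=
  aeval_X _ _

theorem linearSubst_C (L : polyGrading n K 1 →ₗ[K] polyGrading n K 1) (r : K) :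
    linearSubst L (C r) = C r :=
  (linearSubst L).commutes r

theorem linearSubst_coe (L : polyGrading n K 1 →ₗ[K] polyGrading n K 1) (y : polyGrading n K 1) :
    linearSubst L (y : MvPolynomial (Fin (n + 1)) K) = L y := by
  have h : (linearSubst L).toLinearMap ∘ₗ (polyGrading n K 1).subtype =
      (polyGrading n K 1).subtype ∘ₗ L := by
    refine (linearFormBasis n K).ext fun i ↦ ?_
    rw [linearFormBasis_apply]
    exact linearSubst_X L i
  exact LinearMap.congr_fun h y

theorem linearSubst_comp_of_comp_eq_id {L L' : polyGrading n K 1 →ₗ[K] polyGrading n K 1}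
    (h : L ∘ₗ L' = LinearMap.id) :
    (linearSubst L : MvPolynomial (Fin (n + 1)) K →+* MvPolynomial (Fin (n + 1)) K).comp
      (linearSubst L' : MvPolynomial (Fin (n + 1)) K →+* MvPolynomial (Fin (n + 1)) K) =
      RingHom.id _ := by
  refine ringHom_ext (fun r ↦ ?_) fun i ↦ ?_
  · exact ((linearSubst L).comp (linearSubst L')).commutes r
  · change linearSubst L (linearSubst L' (X i)) = X i
    rw [linearSubst_X, linearSubst_coe, ← LinearMap.comp_apply, h]
    rfl

theorem isLinear_linearSubst {L L' : polyGrading n K 1 →ₗ[K] polyGrading n K 1}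
    (h : L ∘ₗ L' = LinearMap.id) : IsLinear (RingHom.id K)
      (linearSubst L : MvPolynomial (Fin (n + 1)) K →+* MvPolynomial (Fin (n + 1)) K) where
  comp_C := RingHom.ext (linearSubst_C L)
  map_X i := by
    change linearSubst L (X i) ∈ _
    rw [linearSubst_X]
    exact Subtype.prop _
  exists_eq_X i := by
    refine ⟨L' ⟨X i, X_mem_polyGrading i⟩, Subtype.prop _, ?_⟩
    change linearSubst L _ = _
    rw [linearSubst_coe, ← LinearMap.comp_apply, h]
    rfl

theorem isLinear_id :
    IsLinear (RingHom.id K) (RingHom.id (MvPolynomial (Fin (n + 1)) K)) where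
  comp_C := by rw [RingHom.id_comp, RingHom.comp_id]
  map_X := X_mem_polyGrading
  exists_eq_X i := ⟨X i, X_mem_polyGrading i, rfl⟩

theorem isLinear_id_map :
    (isLinear_id : IsLinear (RingHom.id K) (RingHom.id (MvPolynomial (Fin (n + 1)) K))).map =
      𝟙 _ :=
  hom_ext_point fun _ _ θ i hu ↦
    (isLinear_id.point_map θ i i hu hu).trans (Category.comp_id _).symm

theorem isLinear_linearEquiv (L : polyGrading n K 1 ≃ₗ[K] polyGrading n K 1) :
    IsLinear (RingHom.id K) (linearSubst (L : polyGrading n K 1 →ₗ[K] polyGrading n K 1) :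
      MvPolynomial (Fin (n + 1)) K →+* MvPolynomial (Fin (n + 1)) K) :=
  isLinear_linearSubst (LinearEquiv.comp_symm L)

/-- The isomorphism of projective spaces given by a linear automorphism of the linear forms. -/
def linearIso (L : polyGrading n K 1 ≃ₗ[K] polyGrading n K 1) :
    ProjectiveSpace K n ≅ ProjectiveSpace K n where
  hom := (isLinear_linearEquiv L).map
  inv := (isLinear_linearEquiv L.symm).map
  hom_inv_id := ((isLinear_linearEquiv L.symm).map_comp (isLinear_linearEquiv L) isLinear_id
    (linearSubst_comp_of_comp_eq_id (LinearEquiv.comp_symm L))).trans isLinear_id_map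
  inv_hom_id := ((isLinear_linearEquiv L).map_comp (isLinear_linearEquiv L.symm) isLinear_id
    (linearSubst_comp_of_comp_eq_id (LinearEquiv.symm_comp L))).trans isLinear_id_map

theorem linearIso_hom_toSpec (L : polyGrading n K 1 ≃ₗ[K] polyGrading n K 1) :
    (linearIso L).hom ≫ toSpec K n = toSpec K n := by
  refine (isLinear_linearEquiv L).map_toSpec.trans ?_
  rw [CommRingCat.ofHom_id, Spec.map_id, Category.comp_id]

/-- The semilinear endomorphism of the linear forms given by a linear ring homomorphism. -/
def IsLinear.toSemilinear {τ : K →+* K}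
    {F : MvPolynomial (Fin (n + 1)) K →+* MvPolynomial (Fin (n + 1)) K} (h : IsLinear τ F) :
    polyGrading n K 1 →ₛₗ[τ] polyGrading n K 1 where
  toFun y := ⟨F y, h.gradedHom.map_mem y.2⟩
  map_add' x y := Subtype.ext (map_add F _ _)
  map_smul' c x := Subtype.ext (by
    have := RingHom.congr_fun h.comp_C c
    simp only [RingHom.comp_apply] at this
    simp [MvPolynomial.smul_eq_C_mul, this])

theorem IsLinear.comp_linearSubst {τ : K →+* K}
    {F : MvPolynomial (Fin (n + 1)) K →+* MvPolynomial (Fin (n + 1)) K} (h : IsLinear τ F)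
    (L : polyGrading n K 1 →ₗ[K] polyGrading n K 1)
    (hL : ∀ i, F (L ⟨X i, X_mem_polyGrading i⟩) = L ⟨X i, X_mem_polyGrading i⟩) :
    F.comp (linearSubst L : MvPolynomial (Fin (n + 1)) K →+* MvPolynomial (Fin (n + 1)) K) =
      (linearSubst L : MvPolynomial (Fin (n + 1)) K →+* MvPolynomial (Fin (n + 1)) K).comp
        (MvPolynomial.map τ) := by
  refine ringHom_ext (fun r ↦ ?_) fun i ↦ ?_
  · change F (linearSubst L (C r)) = linearSubst L (MvPolynomial.map τ (C r))
    rw [MvPolynomial.map_C, linearSubst_C, linearSubst_C]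
    exact RingHom.congr_fun h.comp_C r
  · change F (linearSubst L (X i)) = linearSubst L (MvPolynomial.map τ (X i))
    rw [MvPolynomial.map_X, linearSubst_X, hL]

theorem IsLinear.comp_linearEquiv {τ : K →+* K}
    {F : MvPolynomial (Fin (n + 1)) K →+* MvPolynomial (Fin (n + 1)) K} (h : IsLinear τ F)
    (L : polyGrading n K 1 ≃ₗ[K] polyGrading n K 1) :
    IsLinear τ (F.comp (linearSubst (L : polyGrading n K 1 →ₗ[K] polyGrading n K 1) :
      MvPolynomial (Fin (n + 1)) K →+* MvPolynomial (Fin (n + 1)) K)) where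
  comp_C := RingHom.ext fun r ↦
    (congrArg F (linearSubst_C _ r)).trans (RingHom.congr_fun h.comp_C r)
  map_X i := by
    change F (linearSubst _ (X i)) ∈ _
    rw [linearSubst_X]
    exact h.gradedHom.map_mem (Subtype.prop _)
  exists_eq_X i := by
    obtain ⟨y, hy, hyi⟩ := h.exists_eq_X i
    refine ⟨L.symm ⟨y, hy⟩, Subtype.prop _, ?_⟩
    change F (linearSubst _ _) = _
    rw [linearSubst_coe, LinearEquiv.coe_coe, L.apply_symm_apply, hyi]

theorem IsLinear.exists_linearIso [IsAlgClosed K] {τ : K →+* K} {q : ℕ} (hq : 1 < q)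
    (hτ : ∀ x, τ x = x ^ q) {F : MvPolynomial (Fin (n + 1)) K →+* MvPolynomial (Fin (n + 1)) K}
    (h : IsLinear τ F) (hF : Set.InjOn F (polyGrading n K 1)) :
    ∃ L : polyGrading n K 1 ≃ₗ[K] polyGrading n K 1,
      h.map ≫ (linearIso L).hom = (linearIso L).hom ≫ ofRingHom n τ := by
  have : FiniteDimensional K (polyGrading n K 1) :=
    (linearFormBasis n K).finiteDimensional_of_finite
  have hd : Module.finrank K (polyGrading n K 1) = n + 1 := by
    rw [Module.finrank_eq_card_basis (linearFormBasis n K), Fintype.card_fin]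
  obtain ⟨b, hb, hb'⟩ := exists_fixed_basis hq hτ _ hd h.toSemilinear fun x y hxy ↦
    Subtype.ext (hF x.2 y.2 (congrArg Subtype.val hxy))
  let b' := basisOfLinearIndependentOfCardEqFinrank hb ((Fintype.card_fin _).trans hd.symm)
  obtain ⟨L, hL⟩ : ∃ L : polyGrading n K 1 ≃ₗ[K] polyGrading n K 1,
      ∀ i, L ⟨X i, X_mem_polyGrading i⟩ = b i :=
    ⟨(linearFormBasis n K).equiv b' (Equiv.refl _), fun i ↦ by
      rw [← linearFormBasis_apply, Module.Basis.equiv_apply]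
      simp [b']⟩
  have hcomp := h.comp_linearSubst (L : polyGrading n K 1 →ₗ[K] polyGrading n K 1) fun i ↦ by
    rw [LinearEquiv.coe_coe, hL]
    exact congrArg Subtype.val (hb' i)
  have h1 : h.map ≫ (linearIso L).hom = (h.comp_linearEquiv L).map :=
    (isLinear_linearEquiv L).map_comp h (h.comp_linearEquiv L) rfl
  have h2 : (linearIso L).hom ≫ ofRingHom n τ = (h.comp_linearEquiv L).map :=
    (isLinear_map τ).map_comp (isLinear_linearEquiv L) (h.comp_linearEquiv L) hcomp.symm
  exact ⟨L, h1.trans h2.symm⟩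
end

/-- A semilinear automorphism of projective space is given by a linear ring homomorphism. -/
theorem exists_isLinear_map_eq_hom {K : Type u} [Field K] [Infinite K] {n : ℕ}
    (ψ : ProjectiveSpace K n ≅ ProjectiveSpace K n) (τ : K ≃+* K)
    (hψ : ψ.hom ≫ toSpec K n = toSpec K n ≫ Spec.map (CommRingCat.ofHom (τ : K →+* K))) :
    ∃ (F : MvPolynomial (Fin (n + 1)) K →+* MvPolynomial (Fin (n + 1)) K)
      (h : IsLinear (τ : K →+* K) F), h.map = ψ.hom ∧ Set.InjOn F (polyGrading n K 1) := by
  obtain ⟨F, h1, h2, h3, h4, h5⟩ := exists_linear_represents ψ τ hψ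
  have h : IsLinear (τ : K →+* K) F := ⟨h2, h3, h4⟩
  refine ⟨F, h, ?_, h5⟩
  let θ := algebraMap (MvPolynomial (Fin (n + 1)) K) (FractionRing (MvPolynomial (Fin (n + 1)) K))
  have hθ : Function.Injective θ := IsFractionRing.injective _ _
  have hu (i) : IsUnit (θ (X i)) :=
    ((map_ne_zero_iff _ hθ).mpr (X_ne_zero i)).isUnit
  have hF0 : F (X 0) ≠ 0 := fun h0 ↦ X_ne_zero (R := K) (0 : Fin (n + 1))
    (h5 (X_mem_polyGrading 0) (Submodule.zero_mem _) (h0.trans (map_zero F).symm))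
  have hu' : IsUnit ((θ.comp F) (X 0)) := ((map_ne_zero_iff _ hθ).mpr hF0).isUnit
  have : IsDominant (point θ 0 (hu 0)) := isDominant_point θ hθ hu 0
  have : (ProjectiveSpace K n).IsSeparated :=
    inferInstanceAs (Scheme.IsSeparated (Proj (polyGrading n K)))
  exact ext_of_isDominant (ι := point θ 0 (hu 0))
    ((h.point_map θ 0 0 (hu 0) hu').trans (h1 0 (hu 0) 0 hu').symm)

end ProjectiveSpace

namespace schemeBaseChange
variable {k K : Type u} [Field k] [Field K] [Algebra k K] {P : Scheme.{u}}
  (sP : P ⟶ Spec (CommRingCat.of k))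

theorem galois_toSpec (σ : K ≃ₐ[k] K) :
    galois sP σ ≫ toSpec (algebraMap k K) sP =
      toSpec (algebraMap k K) sP ≫ Spec.map (CommRingCat.ofHom (σ : K →+* K)) :=
  map_toSpec sP (σ : K →+* K) (AlgHom.comp_algebraMap (σ : K →ₐ[k] K))

/-- The Galois action on the base change to a field extension, by isomorphisms. -/
def galoisIso (σ : K ≃ₐ[k] K) :
    schemeBaseChange (algebraMap k K) sP ≅ schemeBaseChange (algebraMap k K) sP where
  hom := galois sP σ
  inv := galois sP σ⁻¹
  hom_inv_id := by rw [← galois_mul, mul_inv_cancel, galois_one]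
  inv_hom_id := by rw [← galois_mul, inv_mul_cancel, galois_one]

end schemeBaseChange

theorem exists_iso_of_finite_of_isAlgClosed {k K : Type u} [Field k] [Finite k] [Field K]
    [Algebra k K] [Algebra.IsAlgebraic k K] [IsAlgClosed K] {P : Scheme.{u}}
    {sP : P ⟶ Spec (CommRingCat.of k)} {n : ℕ}
    (e : schemeBaseChange (algebraMap k K) sP ≅ ProjectiveSpace K n)
    (he : e.hom ≫ ProjectiveSpace.toSpec K n = schemeBaseChange.toSpec (algebraMap k K) sP) :
    ∃ e : P ≅ ProjectiveSpace k n, e.hom ≫ ProjectiveSpace.toSpec k n = sP := by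
  have := Fintype.ofFinite k
  let σ : K ≃ₐ[k] K := FiniteField.frobeniusAlgEquivOfAlgebraic k K
  have hσ (x : K) : σ x = x ^ Fintype.card k := rfl
  have hfix (x : K) (hx : σ x = x) : x ∈ (algebraMap k K).range :=
    mem_range_of_frobenius_eq (by rw [Nat.card_eq_fintype_card]; exact hx)
  have : Infinite K := IsAlgClosed.instInfinite
  obtain ⟨F, hF, hFψ, hinj⟩ := ProjectiveSpace.exists_isLinear_map_eq_hom
    (e.symm ≪≫ schemeBaseChange.galoisIso sP σ ≪≫ e) (σ : K ≃+* K) (by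
      change (e.inv ≫ schemeBaseChange.galois sP σ ≫ e.hom) ≫ _ = _
      rw [Category.assoc, Category.assoc, he, schemeBaseChange.galois_toSpec, ← he,
        Category.assoc, Iso.inv_hom_id_assoc]
      rfl)
  obtain ⟨L, hL⟩ := hF.exists_linearIso Fintype.one_lt_card hσ hinj
  refine exists_iso_of_galois_equivariant σ hfix (e ≪≫ ProjectiveSpace.linearIso L) ?_ ?_
  · rw [Iso.trans_hom, Category.assoc, ProjectiveSpace.linearIso_hom_toSpec, he]
  · have h1 : ProjectiveSpace.ofRingHom n (σ : K →+* K) ≫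
        ProjectiveSpace.ofRingHom n (algebraMap k K) =
        ProjectiveSpace.ofRingHom n (algebraMap k K) :=
      (ProjectiveSpace.isLinear_map (algebraMap k K)).map_comp
        (ProjectiveSpace.isLinear_map (σ : K →+* K)) (ProjectiveSpace.isLinear_map _) (by
          refine ringHom_ext (fun r ↦ ?_) fun i ↦ ?_
          · simp
          · simp)
    have h2 : schemeBaseChange.galois sP σ ≫ e.hom = e.hom ≫ hF.map := by
      rw [hFψ]
      exact (e.hom_inv_id_assoc _).symm
    change schemeBaseChange.galois sP σ ≫ (e.hom ≫ _) ≫ _ = (e.hom ≫ _) ≫ _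
    rw [Category.assoc, reassoc_of% h2, reassoc_of% hL]
    erw [h1]

end

/-- Wedderburn's theorem.  Every Severi–Brauer variety over a finite field
`k = F_q` is isomorphic over `k` to projective space. -/
theorem severiBrauer_trivial_over_finite_field {k : Type u} [Field k] [Finite k]
    {P : Scheme.{u}} (sP : P ⟶ Spec (CommRingCat.of k)) (n : ℕ) (hSB : IsSeveriBrauer sP n) :
    ∃ e : P ≅ ProjectiveSpace k n, e.hom ≫ ProjectiveSpace.toSpec k n = sP := by
  obtain ⟨e, he⟩ := hSB.exists_iso
  exact exists_iso_of_finite_of_isAlgClosed e he
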